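/- arXiv:1703.01015 — 3 statements merged into one kernel-verified Lean document; each statement's English description precedes it below -/
import Mathlib

section
/- Let p ∈ [1,∞] and let φ be a nonnegative function in L¹_loc(0,∞) with ∫₀^∞ t^{1/p−1} φ(t) dt < ∞ (with the convention 1/∞ = 0). Then for every f ∈ H_a^p(ℂ₊), the boundary value function of 𝓗_φ f equals H_φ applied to the boundary value function of f; that is, for almost every x ∈ ℝ, lim_{y→0⁺} (𝓗_φ f)(x+iy) = ∫₀^∞ f*(x/t) φ(t)/t dt, where f*(x) := lim_{y→0⁺} f(x+iy) is the almost-everywhere existing boundary value function of f. -/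
open MeasureTheory Complex Filter Set Topology ENNReal NNReal

/-- The Hardy norm on the upper half-plane: `sup_{y>0} ‖f (· + iy)‖_{L^p(ℝ)}`
(for `p = ∞` this is the sup norm, via the essential supremum on each horizontal line). -/
noncomputable def hardyNorm (p : ℝ≥0∞) (f : ℂ → ℂ) : ℝ≥0∞ :=
  ⨆ y ∈ Set.Ioi (0 : ℝ), eLpNorm (fun x : ℝ => f (x + y * Complex.I)) p volume

/-- Membership in the holomorphic Hardy space `H_a^p(ℂ₊)`. -/
def MemHardy (p : ℝ≥0∞) (f : ℂ → ℂ) : Prop :=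
  DifferentiableOn ℂ f {z : ℂ | 0 < z.im} ∧ hardyNorm p f < ⊤

/-- The Hausdorff operator on holomorphic functions on the upper half-plane:
`𝓗_φ f (z) = ∫₀^∞ f(z/t) φ(t)/t dt`. -/
noncomputable def hausdorffC (φ : ℝ → ℝ) (f : ℂ → ℂ) (z : ℂ) : ℂ :=
  ∫ t in Set.Ioi (0 : ℝ), (φ t / t) • f (z / (t : ℂ))




lemma hh_submean (F : ℂ → ℂ) (r : ℝ) (hr : 0 < r)
    (hF : AnalyticOnNhd ℂ F (Metric.closedBall 0 r)) (s : ℝ) (hs : 0 < s) :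
    ‖F 0‖ ^ s ≤ Real.circleAverage (fun z => ‖F z‖ ^ s) 0 r := by
  have hcont : ContinuousOn (fun z => ‖F z‖ ^ s) (Metric.sphere 0 r) := by
    refine ContinuousOn.rpow_const ?_ (fun _ _ => Or.inr hs.le)
    exact (hF.continuousOn.mono Metric.sphere_subset_closedBall).norm
  have hci : CircleIntegrable (fun z => ‖F z‖ ^ s) 0 r := hcont.circleIntegrable hr.le
  by_cases h0 : F 0 = 0
  · rw [h0, norm_zero, Real.zero_rpow hs.ne']
    apply Real.circleAverage_nonneg_of_nonneg
    intro x _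
    positivity
  have hF' : AnalyticOnNhd ℂ F (Metric.closedBall 0 |r|) := by rwa [abs_of_pos hr]
  have hJ := hF'.circleAverage_log_norm hr.ne' h0
  have hlogint : CircleIntegrable (Real.log ‖F ·‖) 0 r := by
    apply MeromorphicOn.circleIntegrable_log_norm
    intro z hz
    exact (hF' z (Metric.sphere_subset_closedBall hz)).meromorphicAt
  set A := Real.circleAverage (Real.log ‖F ·‖) 0 r with hA
  have hge : Real.log ‖F 0‖ ≤ A := by
    rw [hJ]
    have : 0 ≤ ∑ᶠ u, (MeromorphicOn.divisor F (Metric.closedBall 0 |r|) u : ℝ) *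
        Real.log (r * ‖0 - u‖⁻¹) := by
      apply finsum_nonneg
      intro u
      by_cases hu : u ∈ Metric.closedBall (0:ℂ) |r|
      · apply mul_nonneg
        · exact_mod_cast (MeromorphicOn.AnalyticOnNhd.divisor_nonneg hF') u
        · by_cases hu0 : u = 0
          · simp [hu0]
          apply Real.log_nonneg
          have : 0 < ‖u‖ := norm_pos_iff.mpr hu0
          have h2 : ‖u‖ ≤ r := by simpa [abs_of_pos hr] using hu
          rw [zero_sub, norm_neg, ← div_eq_mul_inv, le_div_iff₀ this]
          linarith
      · simp [hu]
    linarith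
  have hae : ∀ᵐ θ : ℝ, F (circleMap 0 r θ) ≠ 0 := by
    have h1 := hF'.preimage_zero_mem_codiscreteWithin (x := 0) h0 (by simp)
      ((convex_closedBall _ _).isConnected ⟨0, by simp⟩)
    have h2 : F ⁻¹' {0}ᶜ ∈ codiscreteWithin (Metric.sphere (0:ℂ) |r|) :=
      codiscreteWithin_mono Metric.sphere_subset_closedBall h1
    have h3 := circleMap_preimage_codiscrete hr.ne' h2
    have h4 := ae_restrict_le_codiscreteWithin (μ := (volume : Measure ℝ)) MeasurableSet.univ h3
    rw [Measure.restrict_univ] at h4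
    filter_upwards [h4] with θ hθ
    simpa using hθ
  have hpt : ∀ᵐ θ : ℝ, Real.exp (s * A) * (1 + s * (Real.log ‖F (circleMap 0 r θ)‖ - A)) ≤
      ‖F (circleMap 0 r θ)‖ ^ s := by
    filter_upwards [hae] with θ hθ
    have hpos : 0 < ‖F (circleMap 0 r θ)‖ := norm_pos_iff.mpr hθ
    rw [Real.rpow_def_of_pos hpos]
    have := Real.add_one_le_exp (s * (Real.log ‖F (circleMap 0 r θ)‖ - A))
    calc _ ≤ Real.exp (s * A) * Real.exp (s * (Real.log ‖F (circleMap 0 r θ)‖ - A)) := by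
          gcongr; linarith
      _ = _ := by rw [← Real.exp_add]; congr 1; ring
  have hint : Real.exp (s * A) ≤ Real.circleAverage (fun z => ‖F z‖ ^ s) 0 r := by
    have h2 : (2 * Real.pi)⁻¹ * ∫ θ in (0:ℝ)..2 * Real.pi,
        Real.exp (s * A) * (1 + s * (Real.log ‖F (circleMap 0 r θ)‖ - A)) = Real.exp (s * A) := by
      have hA' : (∫ θ in (0:ℝ)..2 * Real.pi, Real.log ‖F (circleMap 0 r θ)‖) = 2 * Real.pi * A := by
        rw [hA, Real.circleAverage_def, smul_eq_mul]
        field_simp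
      have hi : IntervalIntegrable (fun θ => Real.log ‖F (circleMap 0 r θ)‖) volume 0 (2 * Real.pi) :=
        hlogint
      rw [intervalIntegral.integral_const_mul, intervalIntegral.integral_add (by simp)
        ((hi.sub (by simp)).const_mul _), intervalIntegral.integral_const_mul,
        intervalIntegral.integral_sub hi (by simp), hA']
      simp
      field_simp
    rw [← h2, Real.circleAverage_def, smul_eq_mul]
    gcongr
    have hi : IntervalIntegrable (fun θ => Real.log ‖F (circleMap 0 r θ)‖) volume 0 (2 * Real.pi) :=
        hlogint
    apply intervalIntegral.integral_mono_ae (by positivity) _ hci hpt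
    exact ((intervalIntegrable_const).add ((hi.sub (by simp)).const_mul _)).const_mul _
  refine le_trans ?_ hint
  rw [Real.rpow_def_of_pos (norm_pos_iff.mpr h0)]
  apply Real.exp_le_exp.mpr
  nlinarith




lemma hh_arctan_cov (x y : ℝ) (hy : 0 < y) (g : ℝ → ℝ≥0∞) :
    ∫⁻ θ in Ioo (-Real.pi) Real.pi, g θ =
      ∫⁻ t, ENNReal.ofReal (2 * (y / ((x - t) ^ 2 + y ^ 2))) * g (2 * Real.arctan ((t - x) / y)) := by
  have himg : (fun t : ℝ => 2 * Real.arctan ((t - x) / y)) '' univ = Ioo (-Real.pi) Real.pi := by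
    ext θ
    simp only [image_univ, mem_range, mem_Ioo]
    constructor
    · rintro ⟨t, rfl⟩
      have h1 := Real.neg_pi_div_two_lt_arctan ((t - x) / y)
      have h2 := Real.arctan_lt_pi_div_two ((t - x) / y)
      constructor <;> linarith
    · rintro ⟨h1, h2⟩
      refine ⟨x + y * Real.tan (θ / 2), ?_⟩
      rw [add_sub_cancel_left, mul_div_cancel_left₀ _ hy.ne', Real.arctan_tan] <;> linarith
  rw [← himg, lintegral_image_eq_lintegral_abs_deriv_mul MeasurableSet.univ
    (f' := fun t => 2 * (y / ((x - t) ^ 2 + y ^ 2)))]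
  · rw [Measure.restrict_univ]
    apply lintegral_congr
    intro t
    rw [abs_of_nonneg (by positivity)]
  · intro t _
    apply HasDerivAt.hasDerivWithinAt
    have h1 : HasDerivAt (fun t : ℝ => (t - x) / y) (1 / y) t :=
      ((hasDerivAt_id t).sub_const x).div_const y
    convert! (h1.arctan).const_mul 2 using 1
    have : (x - t) ^ 2 + y ^ 2 ≠ 0 := by positivity
    have : 1 + ((t - x) / y) ^ 2 ≠ 0 := by positivity
    have : y ^ 2 + (t - x) ^ 2 ≠ 0 := by positivity
    field_simp
    ring
  · intro a _ b _ hab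
    have : Real.arctan ((a - x) / y) = Real.arctan ((b - x) / y) := by
      simpa using hab
    have := Real.arctan_injective this
    field_simp at this
    linarith

lemma hh_moebius (t : ℝ) :
    Complex.I * ((1 - circleMap 0 1 (2 * Real.arctan t)) / (1 + circleMap 0 1 (2 * Real.arctan t)))
      = t ∧ 1 + circleMap 0 1 (2 * Real.arctan t) ≠ 0 := by
  have h1 : circleMap 0 1 (2 * Real.arctan t) = (1 + t * I) / (1 - t * I) := by
    have hne : (1 - t * I : ℂ) ≠ 0 := by
      intro h
      have := congrArg Complex.re h
      simp at this
    rw [eq_div_iff hne]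
    have hc := Real.cos_sq_arctan t
    have hs : Real.sin (Real.arctan t) = t * Real.cos (Real.arctan t) := by
      rw [← Real.tan_mul_cos (Real.cos_arctan_pos t).ne', Real.tan_arctan]
    have e : circleMap 0 1 (2 * Real.arctan t) =
      ((Real.cos (Real.arctan t) : ℝ) + (Real.sin (Real.arctan t) : ℝ) * I) ^ 2 := by
      rw [ofReal_cos, ofReal_sin, ← Complex.exp_mul_I, ← Complex.exp_nat_mul]
      simp [circleMap]
      ring_nf
    have hc' : ((Real.cos (Real.arctan t) : ℝ) : ℂ) ^ 2 * (1 + t ^ 2) = 1 := by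
      have : Real.cos (Real.arctan t) ^ 2 * (1 + t ^ 2) = 1 := by
        rw [hc]; field_simp
      exact_mod_cast this
    rw [e, hs]
    push_cast at hc' ⊢
    linear_combination (1 + t * I) * hc' - (1 + t * I) * (Complex.cos (Complex.arctan t)) ^ 2 * t ^ 2 * Complex.I_sq
  have hne : (1 - t * I : ℂ) ≠ 0 := by
    intro h
    have := congrArg Complex.re h
    simp at this
  have h2 : 1 + circleMap 0 1 (2 * Real.arctan t) = 2 / (1 - t * I) := by
    rw [h1]; field_simp; ring
  refine ⟨?_, ?_⟩
  · have h3 : 1 - circleMap 0 1 (2 * Real.arctan t) = -(2 * t * I) / (1 - t * I) := by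
      rw [h1]; field_simp; ring
    rw [h2, h3, div_div_div_cancel_right₀ hne]
    linear_combination (-(t : ℂ)) * Complex.I_sq
  · rw [h2]
    exact div_ne_zero two_ne_zero hne

lemma hh_moebius_re (w : ℂ) (hw : ‖w‖ < 1) : 0 < ((1 - w) / (1 + w)).re := by
  have hne : 1 + w ≠ 0 := by
    intro h
    have : w = -1 := by linear_combination h
    rw [this] at hw; simp at hw
  have hn : w.re ^ 2 + w.im ^ 2 < 1 := by
    have : ‖w‖ ^ 2 < 1 := by nlinarith [norm_nonneg w]
    rw [← Complex.normSq_eq_norm_sq, Complex.normSq_apply] at this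
    nlinarith
  rw [Complex.div_re]
  have hp : 0 < Complex.normSq (1 + w) := Complex.normSq_pos.mpr hne
  rw [← add_div]
  apply div_pos _ hp
  simp
  nlinarith

/-- Poisson majorization. -/
lemma hh_poisson (f : ℂ → ℂ) (hf : DifferentiableOn ℂ f {z : ℂ | 0 < z.im}) (ε : ℝ) (hε : 0 < ε)
    (M : ℝ) (hM : ∀ z : ℂ, ε ≤ z.im → ‖f z‖ ≤ M) (s : ℝ) (hs : 0 < s) (x y : ℝ) (hy : 0 < y) :
    ‖f (x + (y + ε : ℝ) * I)‖ₑ ^ s ≤ ENNReal.ofReal (1 / Real.pi) *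
      ∫⁻ t : ℝ, ENNReal.ofReal (y / ((x - t) ^ 2 + y ^ 2)) * ‖f (t + ε * I)‖ₑ ^ s := by
  have hpi := Real.pi_pos
  have hopen : IsOpen {z : ℂ | 0 < z.im} := isOpen_lt continuous_const Complex.continuous_im
  set G : ℂ → ℂ := fun w => x + ε * I + y * (I * ((1 - w) / (1 + w))) with hG
  have hGim : ∀ w : ℂ, ‖w‖ < 1 → ε ≤ (G w).im := by
    intro w hw
    have := hh_moebius_re w hw
    simp only [hG, add_im, ofReal_im, mul_im, ofReal_re, I_re, I_im, mul_re]
    simp only [zero_mul, mul_zero, mul_one, zero_add, add_zero, one_mul, sub_zero]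
    nlinarith
  have hne : ∀ w : ℂ, ‖w‖ < 1 → 1 + w ≠ 0 := by
    intro w hw h
    have : w = -1 := by linear_combination h
    rw [this] at hw; simp at hw
  have hFd : DifferentiableOn ℂ (fun w => f (G w)) (Metric.ball 0 1) := by
    apply hf.comp
    · intro w hw
      have := hne w (by simpa using hw)
      apply DifferentiableAt.differentiableWithinAt
      simp only [hG]
      fun_prop (disch := assumption)
    · intro w hw
      exact lt_of_lt_of_le hε (hGim w (by simpa using hw))
  have hFa : AnalyticOnNhd ℂ (fun w => f (G w)) (Metric.ball 0 1) :=
    hFd.analyticOnNhd Metric.isOpen_ball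
  -- averages
  have hM0 : 0 ≤ M := (norm_nonneg _).trans (hM (ε * I) (by simp))
  have key : ∀ r : ℝ, 0 < r → r < 1 →
      ‖f (G 0)‖ₑ ^ s * ENNReal.ofReal (2 * Real.pi) ≤
        ∫⁻ θ in Ioo (-Real.pi) Real.pi, ‖f (G (circleMap 0 r θ))‖ₑ ^ s := by
    intro r hr hr1
    have h1 := hh_submean (fun w => f (G w)) r hr
      (hFa.mono (Metric.closedBall_subset_ball hr1)) s hs
    have hcont : Continuous (fun θ => ‖f (G (circleMap 0 r θ))‖ ^ s) := by
      refine Continuous.rpow_const ?_ (fun _ => Or.inr hs.le)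
      refine Continuous.norm ?_
      refine hFd.continuousOn.comp_continuous (continuous_circleMap 0 r) ?_
      intro θ
      simp [abs_of_pos hr, hr1]
    have h2 : (∫ θ in Ioo (-Real.pi) Real.pi, ‖f (G (circleMap 0 r θ))‖ ^ s) =
        2 * Real.pi * Real.circleAverage (fun z => ‖f (G z)‖ ^ s) 0 r := by
      rw [Real.circleAverage_eq_integral_add (-Real.pi), smul_eq_mul,
        intervalIntegral.integral_comp_add_right (fun θ => ‖f (G (circleMap 0 r θ))‖ ^ s),
        ← integral_Ioc_eq_integral_Ioo, ← intervalIntegral.integral_of_le (by linarith)]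
      rw [show 0 + -Real.pi = -Real.pi by ring, show 2 * Real.pi + -Real.pi = Real.pi by ring]
      field_simp
    have h3 : (∫⁻ θ in Ioo (-Real.pi) Real.pi, ‖f (G (circleMap 0 r θ))‖ₑ ^ s) =
        ENNReal.ofReal (∫ θ in Ioo (-Real.pi) Real.pi, ‖f (G (circleMap 0 r θ))‖ ^ s) := by
      rw [ofReal_integral_eq_lintegral_ofReal]
      · apply lintegral_congr
        intro θ
        rw [← ENNReal.ofReal_rpow_of_nonneg (norm_nonneg _) hs.le, ofReal_norm]
      · exact (hcont.integrableOn_Icc).mono_set Ioo_subset_Icc_self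
      · exact Eventually.of_forall fun θ => by positivity
    rw [h3, h2, ← ofReal_norm, ENNReal.ofReal_rpow_of_nonneg (norm_nonneg _) hs.le,
      ← ENNReal.ofReal_mul (by positivity), mul_comm]
    apply ENNReal.ofReal_le_ofReal
    gcongr
  -- limit r → 1
  have hlim : ‖f (G 0)‖ₑ ^ s * ENNReal.ofReal (2 * Real.pi) ≤
        ∫⁻ θ in Ioo (-Real.pi) Real.pi, ‖f (G (circleMap 0 1 θ))‖ₑ ^ s := by
    have ht : Tendsto (fun r : ℝ => ∫⁻ θ in Ioo (-Real.pi) Real.pi, ‖f (G (circleMap 0 r θ))‖ₑ ^ s)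
        (𝓝[<] 1) (𝓝 (∫⁻ θ in Ioo (-Real.pi) Real.pi, ‖f (G (circleMap 0 1 θ))‖ₑ ^ s)) := by
      apply tendsto_lintegral_filter_of_dominated_convergence (fun _ => ENNReal.ofReal M ^ s)
      · have : ∀ᶠ r : ℝ in 𝓝[<] 1, r ∈ Ioo (0:ℝ) 1 := Ioo_mem_nhdsLT (by norm_num)
        filter_upwards [this] with r hr
        have hc : Continuous (fun θ => f (G (circleMap 0 r θ))) := by
          refine hFd.continuousOn.comp_continuous (continuous_circleMap 0 r) ?_
          intro θ
          simp [abs_of_pos hr.1, hr.2]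
        exact (hc.measurable.enorm).pow_const s
      · have : ∀ᶠ r : ℝ in 𝓝[<] 1, r ∈ Ioo (0:ℝ) 1 := Ioo_mem_nhdsLT (by norm_num)
        filter_upwards [this] with r hr
        refine Eventually.of_forall fun θ => ?_
        gcongr
        rw [← ofReal_norm]
        apply ENNReal.ofReal_le_ofReal
        apply hM
        apply hGim
        simp [abs_of_pos hr.1, hr.2]
      · rw [lintegral_const]
        apply ENNReal.mul_ne_top
        · exact ENNReal.rpow_ne_top_of_nonneg hs.le ENNReal.ofReal_ne_top
        · simp
      · rw [ae_restrict_iff' measurableSet_Ioo]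
        refine Eventually.of_forall fun θ hθ => ?_
        obtain ⟨hm1, hm2⟩ := hh_moebius (Real.tan (θ / 2))
        rw [Real.arctan_tan (by linarith [hθ.1]) (by linarith [hθ.2]),
          mul_div_cancel₀ _ (two_ne_zero' ℝ)] at hm1 hm2
        have hc1 : ContinuousAt (fun r : ℝ => circleMap 0 r θ) 1 := by
          unfold circleMap; fun_prop
        have hc2 : ContinuousAt G (circleMap 0 1 θ) := by
          simp only [hG]
          fun_prop (disch := assumption)
        have hc3 : ContinuousAt f (G (circleMap 0 1 θ)) := by
          apply (hf.differentiableAt (hopen.mem_nhds _)).continuousAt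
          simp only [hG, hm1]
          simp [hε, -ofReal_tan]
        have hc : ContinuousAt (fun r : ℝ => f (G (circleMap 0 r θ))) 1 :=
          ContinuousAt.comp (f := fun r : ℝ => circleMap 0 r θ) (g := fun w => f (G w))
            (ContinuousAt.comp hc3 hc2) hc1
        have := (ENNReal.continuous_rpow_const (y := s)).continuousAt.comp hc.enorm
        exact this.tendsto.mono_left nhdsWithin_le_nhds
    apply ge_of_tendsto ht
    have : ∀ᶠ r : ℝ in 𝓝[<] 1, r ∈ Ioo (0:ℝ) 1 := Ioo_mem_nhdsLT (by norm_num)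
    filter_upwards [this] with r hr
    exact key r hr.1 hr.2
  rw [hh_arctan_cov x y hy] at hlim
  have hG0 : G 0 = x + (y + ε : ℝ) * I := by simp [hG]; ring
  have hGt : ∀ t : ℝ, G (circleMap 0 1 (2 * Real.arctan ((t - x) / y))) = t + ε * I := by
    intro t
    simp only [hG, (hh_moebius _).1]
    push_cast
    have : (y : ℂ) ≠ 0 := by exact_mod_cast hy.ne'
    field_simp
    ring
  rw [hG0] at hlim
  simp_rw [hGt] at hlim
  have e1 : (∫⁻ t : ℝ, ENNReal.ofReal (2 * (y / ((x - t) ^ 2 + y ^ 2))) * ‖f (t + ε * I)‖ₑ ^ s)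
      = 2 * ∫⁻ t : ℝ, ENNReal.ofReal (y / ((x - t) ^ 2 + y ^ 2)) * ‖f (t + ε * I)‖ₑ ^ s := by
    rw [← lintegral_const_mul' _ _ (by simp)]
    apply lintegral_congr
    intro t
    rw [ENNReal.ofReal_mul (by norm_num), mul_assoc]
    simp
  rw [e1] at hlim
  set J := ∫⁻ t : ℝ, ENNReal.ofReal (y / ((x - t) ^ 2 + y ^ 2)) * ‖f (t + ε * I)‖ₑ ^ s
  have e2 : ENNReal.ofReal (2 * Real.pi) * ENNReal.ofReal (1 / (2 * Real.pi)) = 1 := by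
    rw [← ENNReal.ofReal_mul (by positivity), mul_one_div_cancel (by positivity), ENNReal.ofReal_one]
  calc ‖f (x + (y + ε : ℝ) * I)‖ₑ ^ s
      = ‖f (x + (y + ε : ℝ) * I)‖ₑ ^ s * ENNReal.ofReal (2 * Real.pi)
          * ENNReal.ofReal (1 / (2 * Real.pi)) := by rw [mul_assoc, e2, mul_one]
    _ ≤ 2 * J * ENNReal.ofReal (1 / (2 * Real.pi)) := by gcongr
    _ = (ENNReal.ofReal 2 * ENNReal.ofReal (1 / (2 * Real.pi))) * J := by
        simp only [ENNReal.ofReal_ofNat]; ring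
    _ = _ := by
        rw [← ENNReal.ofReal_mul (by norm_num)]
        congr 2
        field_simp




lemma hh_meas (f : ℂ → ℂ) (hf : DifferentiableOn ℂ f {z : ℂ | 0 < z.im}) :
    Measurable (indicator {z : ℂ | 0 < z.im} f) := by
  have hopen : IsOpen {z : ℂ | 0 < z.im} := isOpen_lt continuous_const Complex.continuous_im
  classical
  have := hf.continuousOn.measurable_piecewise (g := (0 : ℂ → ℂ)) continuousOn_const
    hopen.measurableSet
  rwa [piecewise_eq_indicator] at this

lemma hh_bdd (f : ℂ → ℂ) (hf : DifferentiableOn ℂ f {z : ℂ | 0 < z.im}) (P : ℝ) (hP : 1 ≤ P)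
    (B : ℝ≥0∞) (hB : B ≠ ⊤) (hL : ∀ y : ℝ, 0 < y → ∫⁻ x : ℝ, ‖f (x + y * I)‖ₑ ^ P ≤ B)
    (ε : ℝ) (hε : 0 < ε) : ∃ M : ℝ, ∀ z : ℂ, ε ≤ z.im → ‖f z‖ ≤ M := by
  have hpi := Real.pi_pos
  have hopen : IsOpen {z : ℂ | 0 < z.im} := isOpen_lt continuous_const Complex.continuous_im
  set ft := indicator {z : ℂ | 0 < z.im} f with hft
  have hftm : Measurable ft := hh_meas f hf
  have hfteq : ∀ z : ℂ, 0 < z.im → ft z = f z := fun z hz => indicator_of_mem (show z ∈ {z : ℂ | 0 < z.im} from hz) f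
  set δ := ε / 2 with hδ
  have hδp : 0 < δ := by positivity
  set C : ℝ≥0∞ := ENNReal.ofReal (2 * δ) * (ENNReal.ofReal (2 * δ) + B) with hC
  set c : ℝ≥0∞ := ENNReal.ofReal (δ / 2) * ENNReal.ofReal (2 * Real.pi) * ENNReal.ofReal (δ / 2) with hc
  have hc0 : c ≠ 0 := by
    simp only [hc, ne_eq, mul_eq_zero, ENNReal.ofReal_eq_zero, not_or, not_le]
    refine ⟨⟨?_, ?_⟩, ?_⟩ <;> positivity
  have hct : c ≠ ⊤ := by
    simp only [hc]
    finiteness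
  have hCt : C ≠ ⊤ := by
    simp only [hC]
    finiteness
  have main : ∀ z : ℂ, ε ≤ z.im → ‖f z‖ₑ * c ≤ C := by
    intro z hz
    have him : ∀ w : ℂ, ‖w‖ < ε → 0 < (z + w).im := by
      intro w hw
      have := (abs_le.mp (Complex.abs_im_le_norm w)).1
      rw [add_im]; linarith
    have hFd : DifferentiableOn ℂ (fun w => f (z + w)) (Metric.ball 0 ε) := by
      apply hf.comp (by fun_prop)
      intro w hw
      exact him w (by simpa using hw)
    have hFa := hFd.analyticOnNhd Metric.isOpen_ball
    have key : ∀ r : ℝ, 0 < r → r < ε →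
        ‖f z‖ₑ * ENNReal.ofReal (2 * Real.pi) ≤
          ∫⁻ θ in Ioo (-Real.pi) Real.pi, ‖ft (z + circleMap 0 r θ)‖ₑ := by
      intro r hr hr1
      have h1 := hh_submean (fun w => f (z + w)) r hr
        (hFa.mono (Metric.closedBall_subset_ball hr1)) 1 one_pos
      simp only [Real.rpow_one, add_zero] at h1
      have hcont : Continuous (fun θ => ‖f (z + circleMap 0 r θ)‖) := by
        refine Continuous.norm ?_
        refine hFd.continuousOn.comp_continuous (continuous_circleMap 0 r) ?_
        intro θ
        simp [abs_of_pos hr, hr1]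
      have h2 : (∫ θ in Ioo (-Real.pi) Real.pi, ‖f (z + circleMap 0 r θ)‖) =
          2 * Real.pi * Real.circleAverage (fun w => ‖f (z + w)‖) 0 r := by
        rw [Real.circleAverage_eq_integral_add (-Real.pi), smul_eq_mul,
          intervalIntegral.integral_comp_add_right (fun θ => ‖f (z + circleMap 0 r θ)‖),
          ← integral_Ioc_eq_integral_Ioo, ← intervalIntegral.integral_of_le (by linarith)]
        rw [show 0 + -Real.pi = -Real.pi by ring, show 2 * Real.pi + -Real.pi = Real.pi by ring]
        field_simp
      have h3 : (∫⁻ θ in Ioo (-Real.pi) Real.pi, ‖ft (z + circleMap 0 r θ)‖ₑ) =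
          ENNReal.ofReal (∫ θ in Ioo (-Real.pi) Real.pi, ‖f (z + circleMap 0 r θ)‖) := by
        rw [ofReal_integral_eq_lintegral_ofReal]
        · apply lintegral_congr
          intro θ
          rw [ofReal_norm, hfteq _ (him _ _)]
          simp [abs_of_pos hr, hr1]
        · exact (hcont.integrableOn_Icc).mono_set Ioo_subset_Icc_self
        · exact Eventually.of_forall fun θ => by positivity
      rw [h3, h2, ← ofReal_norm, ← ENNReal.ofReal_mul (by positivity), mul_comm]
      apply ENNReal.ofReal_le_ofReal
      gcongr
    set g : ℂ → ℝ≥0∞ := indicator (Metric.ball 0 δ) (fun w => ‖ft (z + w)‖ₑ) with hg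
    have hgm : Measurable g :=
      (hftm.comp (measurable_const_add z)).enorm.indicator Metric.isOpen_ball.measurableSet
    have s1 : ‖f z‖ₑ * c ≤ ∫⁻ r in Ioo (δ / 2) δ, ∫⁻ θ in Ioo (-Real.pi) Real.pi,
        ENNReal.ofReal r * g (circleMap 0 r θ) := by
      have : ‖f z‖ₑ * c = ∫⁻ r in Ioo (δ / 2) δ, ENNReal.ofReal (δ / 2) * (‖f z‖ₑ * ENNReal.ofReal (2 * Real.pi)) := by
        rw [lintegral_const, Measure.restrict_apply_univ, Real.volume_Ioo,
          show δ - δ / 2 = δ / 2 by ring]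
        simp only [hc]
        ring
      rw [this]
      apply setLIntegral_mono' measurableSet_Ioo
      intro r hr
      rw [lintegral_const_mul' _ _ ENNReal.ofReal_ne_top]
      have hr0 : 0 < r := lt_trans (by positivity) hr.1
      gcongr
      · exact hr.1.le
      · refine (key r hr0 (by linarith [hr.2])).trans (lintegral_mono fun θ => ?_)
        rw [hg, indicator_of_mem]
        simpa [abs_of_pos hr0] using hr.2
    have s2 : (∫⁻ r in Ioo (δ / 2) δ, ∫⁻ θ in Ioo (-Real.pi) Real.pi,
        ENNReal.ofReal r * g (circleMap 0 r θ)) ≤ ∫⁻ w, g w := by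
      rw [← Complex.lintegral_comp_polarCoord_symm]
      have hmm : Measurable (fun q : ℝ × ℝ => ENNReal.ofReal q.1 * g (circleMap 0 q.1 q.2)) := by
        have : Measurable (fun q : ℝ × ℝ => circleMap 0 q.1 q.2) := by
          unfold circleMap; fun_prop
        exact (measurable_fst.ennreal_ofReal).mul (hgm.comp this)
      rw [← setLIntegral_prod (fun q : ℝ × ℝ => ENNReal.ofReal q.1 * g (circleMap 0 q.1 q.2))
        hmm.aemeasurable]
      have : ∀ q : ℝ × ℝ, Complex.polarCoord.symm q = circleMap 0 q.1 q.2 := by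
        intro q
        rw [Complex.polarCoord_symm_apply, circleMap, Complex.exp_mul_I]
        simp
      simp_rw [this, smul_eq_mul]
      apply lintegral_mono_set
      rw [polarCoord_target]
      apply prod_mono _ (subset_refl _)
      intro r hr
      exact lt_trans (by positivity) hr.1
    have s3 : (∫⁻ w, g w) ≤ C := by
      rw [← Complex.volume_preserving_equiv_real_prod.symm.lintegral_comp hgm,
        Measure.volume_eq_prod, lintegral_prod_symm' (fun q : ℝ × ℝ => g (Complex.measurableEquivRealProd.symm q))
          (hgm.comp (MeasurableEquiv.measurable _))]
      have hpt : ∀ b a : ℝ, g (Complex.measurableEquivRealProd.symm (a, b)) ≤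
          indicator (Ioo (-δ) δ) (fun b => indicator (Ioo (-δ) δ) (fun _ => (1:ℝ≥0∞)) a
            + ‖ft ((z.re + a : ℝ) + (z.im + b : ℝ) * I)‖ₑ ^ P) b := by
        intro b a
        have e : Complex.measurableEquivRealProd.symm (a, b) = a + b * I := by
          rw [Complex.measurableEquivRealProd_symm_apply]
          apply Complex.ext <;> simp
        rw [e, hg]
        by_cases hm : (a + b * I : ℂ) ∈ Metric.ball (0:ℂ) δ
        · rw [indicator_of_mem hm]
          have hn : ‖(a + b * I : ℂ)‖ < δ := by simpa using hm
          have h1 := (Complex.abs_re_le_norm (a + b * I)).trans_lt hn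
          have h2 := (Complex.abs_im_le_norm (a + b * I)).trans_lt hn
          simp at h1 h2
          rw [indicator_of_mem (mem_Ioo.mpr (abs_lt.mp h2)), indicator_of_mem (mem_Ioo.mpr (abs_lt.mp h1))]
          have e2 : z + (a + b * I) = (z.re + a : ℝ) + (z.im + b : ℝ) * I := by
            apply Complex.ext <;> simp
          rw [e2]
          rcases le_total (‖ft ((z.re + a : ℝ) + (z.im + b : ℝ) * I)‖ₑ) 1 with h | h
          · exact h.trans le_self_add
          · refine le_trans ?_ le_add_self
            nth_rewrite 1 [← ENNReal.rpow_one (‖ft ((z.re + a : ℝ) + (z.im + b : ℝ) * I)‖ₑ)]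
            exact ENNReal.rpow_le_rpow_of_exponent_le h hP
        · rw [indicator_of_notMem hm]; exact zero_le
      calc _ ≤ ∫⁻ b : ℝ, indicator (Ioo (-δ) δ) (fun _ => ENNReal.ofReal (2 * δ) + B) b := by
            apply lintegral_mono
            intro b
            refine (lintegral_mono (hpt b)).trans ?_
            by_cases hb : b ∈ Ioo (-δ) δ
            · simp only [indicator_of_mem hb]
              rw [lintegral_add_left (measurable_const.indicator measurableSet_Ioo),
                lintegral_indicator measurableSet_Ioo]
              gcongr
              · rw [lintegral_const, Measure.restrict_apply_univ, Real.volume_Ioo, one_mul,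
                  show δ - -δ = 2 * δ by ring]
              · have hpos : 0 < z.im + b := by linarith [hb.1]
                rw [lintegral_add_left_eq_self (fun a : ℝ => ‖ft ((a : ℝ) + (z.im + b : ℝ) * I)‖ₑ ^ P) z.re]
                refine le_trans (le_of_eq ?_) (hL _ hpos)
                apply lintegral_congr
                intro a
                rw [hfteq]
                simpa using hpos
            · simp [indicator_of_notMem hb]
        _ = C := by
            rw [lintegral_indicator measurableSet_Ioo, lintegral_const, Measure.restrict_apply_univ,
              Real.volume_Ioo, hC, mul_comm]
            congr 2; ring
    exact s1.trans (s2.trans s3)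
  refine ⟨(C / c).toReal, fun z hz => ?_⟩
  have h := main z hz
  rw [← ENNReal.le_div_iff_mul_le (Or.inl hc0) (Or.inl hct)] at h
  rw [← toReal_enorm]
  exact ENNReal.toReal_mono (ENNReal.div_ne_top hCt hc0) h


lemma hh_cs (f g : ℝ → ℝ≥0∞) (hf : Measurable f) (hg : Measurable g) :
    (∫⁻ x, f x * g x) ^ 2 ≤ (∫⁻ x, f x ^ 2) * ∫⁻ x, g x ^ 2 := by
  have h := ENNReal.lintegral_mul_le_Lp_mul_Lq (volume : Measure ℝ) Real.HolderConjugate.two_two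
    hf.aemeasurable hg.aemeasurable
  have e : ∀ a : ℝ≥0∞, (a ^ (1 / (2:ℝ))) ^ 2 = a := by
    intro a
    rw [← ENNReal.rpow_natCast, ← ENNReal.rpow_mul]
    norm_num
  calc _ ≤ _ := by
        exact pow_le_pow_left' h 2
    _ = _ := by
        rw [mul_pow, e, e]
        simp only [ENNReal.rpow_two]

lemma hh_cancel (A B : ℝ≥0∞) (hA : A ≠ ⊤) (h : A ^ 2 ≤ B * A) : A ≤ B := by
  by_cases h0 : A = 0
  · simp [h0]
  rw [pow_two] at h
  exact (ENNReal.mul_le_mul_iff_left h0 hA).mp h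

lemma hh_kint (a x : ℝ) (ha : 0 < a) :
    ∫⁻ t : ℝ, ENNReal.ofReal (a / ((x - t) ^ 2 + a ^ 2)) = ENNReal.ofReal Real.pi := by
  have hi := integrable_inv_one_add_sq
  have e : ∀ t : ℝ, a / ((x - t) ^ 2 + a ^ 2) = a⁻¹ * (1 + ((t - x) / a) ^ 2)⁻¹ := by
    intro t
    have : (x - t) ^ 2 + a ^ 2 ≠ 0 := by positivity
    have : (a ^ 2 + (t - x) ^ 2) ≠ 0 := by positivity
    field_simp
    ring
  simp_rw [e]
  rw [← ofReal_integral_eq_lintegral_ofReal]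
  · congr 1
    rw [integral_const_mul, integral_sub_right_eq_self (fun t => (1 + (t / a) ^ 2)⁻¹) x,
      Measure.integral_comp_div (fun t => (1 + t ^ 2)⁻¹) a, integral_univ_inv_one_add_sq, abs_of_pos ha]
    simp
    field_simp
  · exact (((hi.comp_div ha.ne').comp_sub_right x)).const_mul _
  · exact Eventually.of_forall fun t => by positivity

lemma hh_kpt (a b x x' t : ℝ) (ha : 0 < a) (hb : 0 < b) :
    a / ((x - t) ^ 2 + a ^ 2) * (b / ((x' - t) ^ 2 + b ^ 2)) ≤
      4 * (a / ((x - x') ^ 2 + a ^ 2)) * (b / ((x' - t) ^ 2 + b ^ 2)) +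
      4 * (b / ((x' - x) ^ 2 + b ^ 2)) * (a / ((x - t) ^ 2 + a ^ 2)) := by
  have aux : ∀ a d e : ℝ, 0 < a → d ^ 2 ≤ 4 * e ^ 2 → a / (e ^ 2 + a ^ 2) ≤ 4 * (a / (d ^ 2 + a ^ 2)) := by
    intro a d e ha h
    rw [← mul_div_assoc, div_le_div_iff₀ (by positivity) (by positivity)]
    nlinarith [sq_nonneg a, mul_pos ha (pow_pos ha 2)]
  have p1 : 0 ≤ a / ((x - t) ^ 2 + a ^ 2) := by positivity
  have p2 : 0 ≤ b / ((x' - t) ^ 2 + b ^ 2) := by positivity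
  have p3 : 0 ≤ a / ((x - x') ^ 2 + a ^ 2) := by positivity
  have p4 : 0 ≤ b / ((x' - x) ^ 2 + b ^ 2) := by positivity
  by_cases h : (x - x') ^ 2 ≤ 4 * (x - t) ^ 2
  · have := aux a _ _ ha h
    nlinarith [mul_le_mul_of_nonneg_right this p2, mul_nonneg p4 p1]
  · have h' : (x' - x) ^ 2 ≤ 4 * (x' - t) ^ 2 := by
      push Not at h
      nlinarith [sq_nonneg (x - x' - 2 * (x - t)), sq_nonneg (x - x' + 2 * (x - t)), sq_nonneg (x-x' - 2 * (x'-t)), sq_nonneg ((x - t) + (x' - t))]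
    have := aux b _ _ hb h'
    nlinarith [mul_le_mul_of_nonneg_right this p1, mul_nonneg p3 p2]

lemma hh_fin (h : ℝ → ℝ≥0∞) (hh : Measurable h) (κ : ℝ → ℝ → ℝ≥0∞)
    (hκm : Measurable (Function.uncurry κ)) (hκs : ∀ x t, κ x t = κ t x) (c : ℝ≥0∞) (hc : c ≠ ⊤)
    (hκi : ∀ x, (∫⁻ t, κ x t) = c) (hfin : ∫⁻ x, h x ^ 2 ≠ ⊤) :
    (∫⁻ x', ∫⁻ x, (h x' ^ 2 * κ x' x + h x ^ 2 * κ x' x)) ≠ ⊤ := by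
  have m1 : Measurable (fun z : ℝ × ℝ => h z.1 ^ 2 * κ z.1 z.2) :=
    ((hh.comp measurable_fst).pow_const 2).mul hκm
  have m2 : Measurable (fun z : ℝ × ℝ => h z.2 ^ 2 * κ z.1 z.2) :=
    ((hh.comp measurable_snd).pow_const 2).mul hκm
  have hκm1 : ∀ x, Measurable (κ x) := fun x => hκm.comp measurable_prodMk_left
  have e : ∀ x', (∫⁻ x, (h x' ^ 2 * κ x' x + h x ^ 2 * κ x' x)) =
      (∫⁻ x, h x' ^ 2 * κ x' x) + ∫⁻ x, h x ^ 2 * κ x' x := fun x' =>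
    lintegral_add_left (m1.comp measurable_prodMk_left) _
  simp_rw [e]
  rw [lintegral_add_left m1.lintegral_prod_right']
  rw [lintegral_lintegral_swap (f := fun x' x => h x ^ 2 * κ x' x) m2.aemeasurable]
  have e' : (∫⁻ y, ∫⁻ x, h y ^ 2 * κ x y) = ∫⁻ x', ∫⁻ x, h x' ^ 2 * κ x' x := by
    apply lintegral_congr; intro x; apply lintegral_congr; intro x'
    rw [hκs]
  rw [e']
  have e'' : (∫⁻ x', ∫⁻ x, h x' ^ 2 * κ x' x) = (∫⁻ x, h x ^ 2) * c := by
    rw [← lintegral_mul_const' _ _ hc]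
    apply lintegral_congr; intro x
    rw [lintegral_const_mul _ (hκm1 x), hκi x]
  rw [e'']
  exact ENNReal.add_ne_top.mpr ⟨ENNReal.mul_ne_top hfin hc, ENNReal.mul_ne_top hfin hc⟩

set_option maxHeartbeats 1600000 in
/-- The linearised Poisson maximal operator is bounded on `L²` (a `T T*` argument). -/
lemma hh_TT (Y : ℝ → ℝ) (hY : Measurable Y) (a b : ℝ) (ha : 0 < a) (hYa : ∀ x, a ≤ Y x)
    (hYb : ∀ x, Y x ≤ b) (h g : ℝ → ℝ≥0∞) (hh : Measurable h) (hg : Measurable g)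
    (hfin : ∫⁻ x, h x ^ 2 ≠ ⊤) :
    (∫⁻ x, h x * ∫⁻ t, ENNReal.ofReal (Y x / ((x - t) ^ 2 + Y x ^ 2)) * g t) ^ 2 ≤
      ENNReal.ofReal (8 * Real.pi) ^ 2 * (∫⁻ x, g x ^ 2) * ∫⁻ x, h x ^ 2 := by
  have hpi := Real.pi_pos
  have hYp : ∀ x, 0 < Y x := fun x => lt_of_lt_of_le ha (hYa x)
  set k : ℝ → ℝ → ℝ≥0∞ := fun x t => ENNReal.ofReal (Y x / ((x - t) ^ 2 + Y x ^ 2)) with hk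
  have hkm : Measurable (Function.uncurry k) := by
    simp only [hk, Function.uncurry_def]
    fun_prop
  have hkm1 : ∀ x, Measurable (k x) := fun x => hkm.comp measurable_prodMk_left
  have hkm2 : ∀ t, Measurable (fun x => k x t) := fun x => hkm.comp measurable_prodMk_right
  set S : ℝ → ℝ≥0∞ := fun t => ∫⁻ x, k x t * h x with hS
  have hSm : Measurable S := by
    apply Measurable.lintegral_prod_left' (f := fun z : ℝ × ℝ => k z.1 z.2 * h z.1)
    exact hkm.mul (hh.comp measurable_fst)
  set A := ∫⁻ t, S t ^ 2 with hA
  set H := ∫⁻ x, h x ^ 2 with hH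
  -- T* pairing
  have hpair : (∫⁻ x, h x * ∫⁻ t, k x t * g t) = ∫⁻ t, g t * S t := by
    have e1 : ∀ x, h x * ∫⁻ t, k x t * g t = ∫⁻ t, h x * (k x t * g t) := by
      intro x
      rw [lintegral_const_mul _ ((hkm1 x).fun_mul hg)]
    simp_rw [e1]
    rw [lintegral_lintegral_swap]
    · apply lintegral_congr
      intro t
      rw [hS, ← lintegral_const_mul _ ((hkm2 t).fun_mul hh)]
      apply lintegral_congr
      intro x
      ring
    · apply Measurable.aemeasurable
      exact (hh.comp measurable_fst).mul (hkm.mul (hg.comp measurable_snd))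
  -- the kernel of T T*
  have hK : ∀ x x', (∫⁻ t, k x t * k x' t) ≤ ENNReal.ofReal (4 * Real.pi) * (k x x' + k x' x) := by
    intro x x'
    have hpt : ∀ t, k x t * k x' t ≤ 4 * k x x' * k x' t + 4 * k x' x * k x t := by
      intro t
      have h4 : (4 : ℝ≥0∞) = ENNReal.ofReal 4 := by simp
      have hx := hYp x
      have hx' := hYp x'
      simp only [hk]
      rw [h4, ← ENNReal.ofReal_mul (by positivity), ← ENNReal.ofReal_mul (by positivity),
        ← ENNReal.ofReal_mul (by positivity), ← ENNReal.ofReal_mul (by positivity),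
        ← ENNReal.ofReal_mul (by positivity), ← ENNReal.ofReal_add (by positivity) (by positivity)]
      exact ENNReal.ofReal_le_ofReal (hh_kpt _ _ _ _ _ hx hx')
    calc (∫⁻ t, k x t * k x' t) ≤ ∫⁻ t, (4 * k x x' * k x' t + 4 * k x' x * k x t) :=
          lintegral_mono hpt
      _ = 4 * k x x' * ENNReal.ofReal Real.pi + 4 * k x' x * ENNReal.ofReal Real.pi := by
          rw [lintegral_add_left ((hkm1 x').const_mul _), lintegral_const_mul _ (hkm1 x'),
            lintegral_const_mul _ (hkm1 x), hh_kint _ _ (hYp x), hh_kint _ _ (hYp x')]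
      _ = _ := by
          rw [ENNReal.ofReal_mul (by norm_num)]
          simp only [ENNReal.ofReal_ofNat]
          ring
  have hA1 : A ≤ ENNReal.ofReal (8 * Real.pi) * ∫⁻ x', h x' * S x' := by
    have e1 : A = ∫⁻ x, ∫⁻ x', h x * h x' * ∫⁻ t, k x t * k x' t := by
      have e2 : ∀ t, S t ^ 2 = ∫⁻ x, ∫⁻ x', k x t * h x * (k x' t * h x') := by
        intro t
        have : ∀ x, (∫⁻ x', k x t * h x * (k x' t * h x')) = k x t * h x * S t := by
          intro x
          rw [lintegral_const_mul _ ((hkm2 t).fun_mul hh)]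
        simp_rw [this]
        rw [lintegral_mul_const _ ((hkm2 t).fun_mul hh), pow_two]
      rw [hA]
      simp_rw [e2]
      have hm3 : Measurable (fun z : ℝ × ℝ × ℝ =>
          k z.2.1 z.1 * h z.2.1 * (k z.2.2 z.1 * h z.2.2)) := by
        refine Measurable.mul (Measurable.mul ?_ ?_) (Measurable.mul ?_ ?_)
        · exact hkm.comp (g := Function.uncurry k) (f := fun z : ℝ × ℝ × ℝ => (z.2.1, z.1)) (by fun_prop)
        · exact hh.comp (by fun_prop)
        · exact hkm.comp (g := Function.uncurry k) (f := fun z : ℝ × ℝ × ℝ => (z.2.2, z.1)) (by fun_prop)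
        · exact hh.comp (by fun_prop)
      rw [lintegral_lintegral_swap]
      · apply lintegral_congr
        intro x
        rw [lintegral_lintegral_swap]
        · apply lintegral_congr
          intro x'
          rw [← lintegral_const_mul _ ((hkm1 x).fun_mul (hkm1 x'))]
          apply lintegral_congr
          intro t
          ring
        · apply Measurable.aemeasurable
          exact hm3.comp (f := fun z : ℝ × ℝ => (z.1, x, z.2)) (by fun_prop)
      · apply Measurable.aemeasurable
        have : Measurable (fun z : (ℝ × ℝ) × ℝ =>
          k z.1.2 z.1.1 * h z.1.2 * (k z.2 z.1.1 * h z.2)) :=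
          hm3.comp (f := fun z : (ℝ × ℝ) × ℝ => (z.1.1, z.1.2, z.2)) (by fun_prop)
        exact this.lintegral_prod_right'
    have hm2 : Measurable (fun z : ℝ × ℝ => h z.1 * h z.2 * k z.1 z.2) :=
      ((hh.comp measurable_fst).mul (hh.comp measurable_snd)).mul hkm
    have hm2' : Measurable (fun z : ℝ × ℝ => h z.1 * h z.2 * k z.2 z.1) :=
      ((hh.comp measurable_fst).mul (hh.comp measurable_snd)).mul (hkm.comp measurable_swap)
    have e3 : (∫⁻ x, ∫⁻ x', h x * h x' * k x' x) = ∫⁻ x', h x' * S x' := by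
      apply lintegral_congr
      intro x
      rw [hS, ← lintegral_const_mul _ ((hkm2 x).fun_mul hh)]
      apply lintegral_congr
      intro x'
      ring
    have e4 : (∫⁻ x, ∫⁻ x', h x * h x' * k x x') = ∫⁻ x', h x' * S x' := by
      rw [lintegral_lintegral_swap hm2.aemeasurable, ← e3]
      apply lintegral_congr; intro x; apply lintegral_congr; intro x'
      ring
    rw [e1]
    calc _ ≤ ∫⁻ x, ∫⁻ x', ENNReal.ofReal (4 * Real.pi) * (h x * h x' * k x x' + h x * h x' * k x' x) := by
          apply lintegral_mono; intro x; apply lintegral_mono; intro x'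
          calc _ ≤ h x * h x' * (ENNReal.ofReal (4 * Real.pi) * (k x x' + k x' x)) := by
                dsimp only
                gcongr
                exact hK x x'
            _ = _ := by ring
      _ = ENNReal.ofReal (4 * Real.pi) * (∫⁻ x', h x' * S x' + h x' * S x') := by
          simp_rw [lintegral_const_mul' _ _ (ENNReal.ofReal_ne_top)]
          congr 1
          rw [lintegral_add_left (hh.fun_mul hSm)]
          nth_rewrite 2 [← e3]
          rw [← e4, ← lintegral_add_left hm2.lintegral_prod_right']
          apply lintegral_congr; intro x
          exact lintegral_add_left (hm2.comp measurable_prodMk_left) _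
      _ = _ := by
          rw [lintegral_add_left (hh.fun_mul hSm), show 8 * Real.pi = 4 * Real.pi + 4 * Real.pi by ring,
            ENNReal.ofReal_add (by positivity) (by positivity)]
          ring
  have hHS : (∫⁻ x', h x' * S x') ≠ ⊤ := by
    set κ : ℝ → ℝ → ℝ≥0∞ := fun x t => ENNReal.ofReal (b / a) * ENNReal.ofReal (a / ((x - t) ^ 2 + a ^ 2)) with hκ
    have hkk : ∀ x t, k x t ≤ κ x t := by
      intro x t
      have hb : 0 < b := lt_of_lt_of_le (hYp x) (hYb x)
      simp only [hk, hκ]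
      rw [← ENNReal.ofReal_mul (by positivity)]
      apply ENNReal.ofReal_le_ofReal
      have h1 := hYa x
      have h2 := hYb x
      rw [div_mul_div_comm, mul_comm a, mul_div_mul_right _ _ ha.ne']
      gcongr
    have hκm : Measurable (Function.uncurry κ) := by
      simp only [hκ, Function.uncurry_def]
      fun_prop
    have hκi : ∀ x, (∫⁻ t, κ x t) = ENNReal.ofReal (b / a) * ENNReal.ofReal Real.pi := by
      intro x
      simp only [hκ]
      rw [lintegral_const_mul' _ _ ENNReal.ofReal_ne_top, hh_kint a x ha]
    have hκs : ∀ x t, κ x t = κ t x := by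
      intro x t
      simp only [hκ]
      rw [show (x - t) ^ 2 = (t - x) ^ 2 by ring]
    have hmul : ∀ u v : ℝ≥0∞, u * v ≤ u ^ 2 + v ^ 2 := by
      intro u v
      rcases le_total u v with huv | huv
      · calc u * v ≤ v * v := by gcongr
          _ ≤ _ := by rw [pow_two v]; exact le_add_self
      · calc u * v ≤ u * u := by gcongr
          _ ≤ _ := by rw [pow_two u]; exact le_self_add
    have hb1 : (∫⁻ x', h x' * S x') ≤ ∫⁻ x', ∫⁻ x, (h x' ^ 2 * κ x' x + h x ^ 2 * κ x' x) := by
      apply lintegral_mono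
      intro x'
      dsimp only
      rw [hS, ← lintegral_const_mul _ ((hkm2 x').fun_mul hh)]
      apply lintegral_mono
      intro x
      calc h x' * (k x x' * h x) = (h x' * h x) * k x x' := by ring
        _ ≤ (h x' ^ 2 + h x ^ 2) * κ x x' := by
            gcongr
            · exact hmul _ _
            · exact hkk _ _
        _ = _ := by rw [hκs x x', add_mul]
    have hc : ENNReal.ofReal (b / a) * ENNReal.ofReal Real.pi ≠ ⊤ :=
      ENNReal.mul_ne_top ENNReal.ofReal_ne_top ENNReal.ofReal_ne_top
    exact ne_top_of_le_ne_top (hh_fin h hh κ hκm hκs _ hc hκi hfin) hb1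
  have hAfin : A ≠ ⊤ := ne_top_of_le_ne_top (ENNReal.mul_ne_top ENNReal.ofReal_ne_top hHS) hA1
  have hA2 : A ≤ ENNReal.ofReal (8 * Real.pi) ^ 2 * H := by
    apply hh_cancel _ _ hAfin
    calc A ^ 2 ≤ (ENNReal.ofReal (8 * Real.pi) * ∫⁻ x', h x' * S x') ^ 2 := by gcongr
      _ = ENNReal.ofReal (8 * Real.pi) ^ 2 * (∫⁻ x', h x' * S x') ^ 2 := mul_pow _ _ _
      _ ≤ ENNReal.ofReal (8 * Real.pi) ^ 2 * (H * A) := by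
          gcongr
          exact hh_cs h S hh hSm
      _ = _ := by ring
  rw [hpair]
  calc _ ≤ (∫⁻ x, g x ^ 2) * A := hh_cs g S hg hSm
    _ ≤ (∫⁻ x, g x ^ 2) * (ENNReal.ofReal (8 * Real.pi) ^ 2 * H) := by gcongr
    _ = _ := by ring

lemma hh_max (Y : ℝ → ℝ) (hY : Measurable Y) (a b : ℝ) (ha : 0 < a) (hYa : ∀ x, a ≤ Y x)
    (hYb : ∀ x, Y x ≤ b) (v g : ℝ → ℝ≥0∞) (hv : Measurable v) (hg : Measurable g)
    (hfin : ∫⁻ x, v x ^ 2 ≠ ⊤)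
    (hvg : ∀ x, v x ≤ ENNReal.ofReal (1 / Real.pi) *
      ∫⁻ t, ENNReal.ofReal (Y x / ((x - t) ^ 2 + Y x ^ 2)) * g t) :
    ∫⁻ x, v x ^ 2 ≤ 64 * ∫⁻ x, g x ^ 2 := by
  have hpi := Real.pi_pos
  apply hh_cancel _ _ hfin
  have h1 := hh_TT Y hY a b ha hYa hYb v g hv hg hfin
  set J : ℝ → ℝ≥0∞ := fun x => ∫⁻ t, ENNReal.ofReal (Y x / ((x - t) ^ 2 + Y x ^ 2)) * g t
  have h2 : (∫⁻ x, v x ^ 2) ≤ ENNReal.ofReal (1 / Real.pi) * ∫⁻ x, v x * J x := by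
    rw [← lintegral_const_mul' _ _ ENNReal.ofReal_ne_top]
    apply lintegral_mono
    intro x
    calc v x ^ 2 = v x * v x := pow_two _
      _ ≤ v x * (ENNReal.ofReal (1 / Real.pi) * J x) := by gcongr; exact hvg x
      _ = _ := by ring
  calc _ ≤ (ENNReal.ofReal (1 / Real.pi) * ∫⁻ x, v x * J x) ^ 2 := by gcongr
    _ = ENNReal.ofReal (1 / Real.pi) ^ 2 * (∫⁻ x, v x * J x) ^ 2 := mul_pow _ _ _
    _ ≤ ENNReal.ofReal (1 / Real.pi) ^ 2 * (ENNReal.ofReal (8 * Real.pi) ^ 2 * (∫⁻ x, g x ^ 2) * ∫⁻ x, v x ^ 2) := by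
        gcongr
    _ = (ENNReal.ofReal (1 / Real.pi) * ENNReal.ofReal (8 * Real.pi)) ^ 2 * (∫⁻ x, g x ^ 2) * ∫⁻ x, v x ^ 2 := by
        ring
    _ = _ := by
        rw [← ENNReal.ofReal_mul (by positivity), show 1 / Real.pi * (8 * Real.pi) = 8 by field_simp]
        norm_num


lemma hh_sel (F : ℕ → ℝ → ℝ≥0∞) (hF : ∀ n, Measurable (F n)) (q : ℕ → ℝ) (n : ℕ) :
    ∃ Y : ℝ → ℝ, ∃ v : ℝ → ℝ≥0∞, Measurable Y ∧ Measurable v ∧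
      ∀ x, (∃ j ≤ n, Y x = q j ∧ v x = F j x) ∧ ∀ j ≤ n, F j x ≤ v x := by
  induction n with
  | zero =>
    refine ⟨fun _ => q 0, F 0, measurable_const, hF 0, fun x => ⟨⟨0, le_rfl, rfl, rfl⟩, ?_⟩⟩
    intro j hj
    rw [Nat.le_zero.mp hj]
  | succ n ih =>
    obtain ⟨Y, v, hY, hv, h⟩ := ih
    classical
    have hs : MeasurableSet {x | v x < F (n + 1) x} := measurableSet_lt hv (hF _)
    refine ⟨fun x => if v x < F (n + 1) x then q (n + 1) else Y x,
      fun x => if v x < F (n + 1) x then F (n + 1) x else v x,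
      Measurable.ite hs measurable_const hY, Measurable.ite hs (hF _) hv, fun x => ?_⟩
    obtain ⟨⟨j, hj, h1, h2⟩, h3⟩ := h x
    by_cases hx : v x < F (n + 1) x
    · simp only [hx, if_true]
      refine ⟨⟨n + 1, le_rfl, rfl, rfl⟩, fun i hi => ?_⟩
      rcases Nat.le_succ_iff.mp hi with hi | hi
      · exact (h3 i hi).trans hx.le
      · rw [hi]
    · simp only [hx, if_false]
      refine ⟨⟨j, by omega, h1, h2⟩, fun i hi => ?_⟩
      rcases Nat.le_succ_iff.mp hi with hi | hi
      · exact h3 i hi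
      · rw [hi]; exact not_lt.mp hx

lemma hh_maximal (f : ℂ → ℂ) (hf : DifferentiableOn ℂ f {z : ℂ | 0 < z.im}) (P : ℝ) (hP : 1 ≤ P)
    (B : ℝ≥0∞) (hB : B ≠ ⊤) (hL : ∀ y : ℝ, 0 < y → ∫⁻ x : ℝ, ‖f (x + y * I)‖ₑ ^ P ≤ B) :
    ∃ N : ℝ → ℝ≥0∞, Measurable N ∧ ∫⁻ x, N x ^ P ≤ 64 * B ∧
      ∀ x y : ℝ, 0 < y → ‖f (x + y * I)‖ₑ ≤ N x := by
  have hP0 : 0 < P := by linarith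
  have hline : ∀ y : ℝ, 0 < y → Measurable (fun x : ℝ => ‖f (x + y * I)‖ₑ) := by
    intro y hy
    refine (hf.continuousOn.comp_continuous (f := fun x : ℝ => (x + y * I : ℂ)) (by fun_prop)
      ?_).measurable.enorm
    intro x
    simpa using hy
  have hsq : ∀ u : ℝ≥0∞, (u ^ (P / 2)) ^ 2 = u ^ P := by
    intro u
    rw [← ENNReal.rpow_natCast, ← ENNReal.rpow_mul]
    congr 1
    push_cast; ring
  set q : ℕ → ℝ := fun n => Real.exp (TopologicalSpace.denseSeq ℝ n) with hq
  have hqp : ∀ n, 0 < q n := fun n => Real.exp_pos _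
  set F : ℕ → ℝ → ℝ≥0∞ := fun n x => ‖f (x + q n * I)‖ₑ ^ (P / 2) with hF
  have hFm : ∀ n, Measurable (F n) := fun n => (hline _ (hqp n)).pow_const _
  choose Y v hY hv h using fun n => hh_sel F hFm q n
  have key : ∀ n, ∫⁻ x, v n x ^ 2 ≤ 64 * B := by
    intro n
    obtain ⟨m, hm, hmin⟩ := (Finset.range (n + 1)).exists_min_image q ⟨0, by simp⟩
    obtain ⟨m', hm', hmax⟩ := (Finset.range (n + 1)).exists_max_image q ⟨0, by simp⟩
    set ε := q m / 2 with hε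
    have hεp : 0 < ε := half_pos (hqp m)
    obtain ⟨M, hM⟩ := hh_bdd f hf P hP B hB hL ε hεp
    have hYa : ∀ x, ε ≤ Y n x - ε := by
      intro x
      obtain ⟨⟨j, hj, h1, h2⟩, h3⟩ := h n x
      have := hmin j (by simp; omega)
      rw [h1]; linarith
    have hYb : ∀ x, Y n x - ε ≤ q m' := by
      intro x
      obtain ⟨⟨j, hj, h1, h2⟩, h3⟩ := h n x
      have := hmax j (by simp; omega)
      rw [h1]; linarith
    have hvF : ∀ x, v n x = ‖f (x + (Y n x - ε + ε : ℝ) * I)‖ₑ ^ (P / 2) := by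
      intro x
      obtain ⟨⟨j, hj, h1, h2⟩, h3⟩ := h n x
      rw [h2, sub_add_cancel, h1]
    have hfin : ∫⁻ x, v n x ^ 2 ≠ ⊤ := by
      have : ∫⁻ x, v n x ^ 2 ≤ ∑ j ∈ Finset.range (n + 1), B := by
        calc _ ≤ ∫⁻ x, ∑ j ∈ Finset.range (n + 1), ‖f ((x : ℝ) + q j * I)‖ₑ ^ P := by
              apply lintegral_mono
              intro x
              obtain ⟨⟨j, hj, h1, h2⟩, h3⟩ := h n x
              dsimp only
              rw [h2, hF, hsq]
              exact Finset.single_le_sum (f := fun j => ‖f ((x : ℝ) + q j * I)‖ₑ ^ P)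
                (fun _ _ => zero_le) (by simp; omega)
          _ = ∑ j ∈ Finset.range (n + 1), ∫⁻ x, ‖f ((x : ℝ) + q j * I)‖ₑ ^ P :=
              lintegral_finsetSum _ (fun j _ => (hline _ (hqp j)).pow_const _)
          _ ≤ _ := Finset.sum_le_sum fun j _ => hL _ (hqp j)
      refine ne_top_of_le_ne_top ?_ this
      simp [ENNReal.mul_eq_top, hB]
    have := hh_max (fun x => Y n x - ε) ((hY n).sub_const _) ε (q m') hεp hYa hYb (v n)
      (fun t => ‖f (t + ε * I)‖ₑ ^ (P / 2)) (hv n) ((hline ε hεp).pow_const _) hfin (by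
        intro x
        rw [hvF x]
        exact hh_poisson f hf ε hεp M hM (P / 2) (by positivity) x (Y n x - ε)
          (hεp.trans_le (hYa x)))
    refine this.trans ?_
    simp_rw [hsq]
    gcongr
    exact hL ε hεp
  have hmono : Monotone fun n x => v n x ^ 2 := by
    intro n m hnm x
    obtain ⟨⟨j, hj, h1, h2⟩, h3⟩ := h n x
    dsimp only
    rw [h2]
    exact pow_le_pow_left' ((h m x).2 j (hj.trans hnm)) 2
  refine ⟨fun x => (⨆ n, v n x ^ 2) ^ (1 / P), ?_, ?_, ?_⟩
  · exact (Measurable.iSup fun n => (hv n).pow_const 2).pow_const _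
  · have : ∀ x, ((⨆ n, v n x ^ 2) ^ (1 / P)) ^ P = ⨆ n, v n x ^ 2 := by
      intro x
      rw [← ENNReal.rpow_mul, one_div_mul_cancel hP0.ne', ENNReal.rpow_one]
    simp_rw [this]
    rw [lintegral_iSup (fun n => (hv n).pow_const 2) hmono]
    exact iSup_le key
  · intro x y hy
    have hcl : ∀ u : ℝ, ‖f (x + (Real.exp u : ℝ) * I)‖ₑ ≤ (⨆ n, v n x ^ 2) ^ (1 / P) := by
      intro u
      have hc : Continuous (fun u : ℝ => ‖f (x + (Real.exp u : ℝ) * I)‖ₑ) := by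
        refine (hf.continuousOn.comp_continuous
          (f := fun u : ℝ => (x + (Real.exp u : ℝ) * I : ℂ)) (by fun_prop) ?_).enorm
        intro u
        simpa [-ofReal_exp] using Real.exp_pos u
      refine (TopologicalSpace.denseRange_denseSeq ℝ).induction_on
        (p := fun u => ‖f (x + (Real.exp u : ℝ) * I)‖ₑ ≤ (⨆ n, v n x ^ 2) ^ (1 / P)) u
        (isClosed_le hc continuous_const) ?_
      intro n
      have h1 : ‖f (x + (q n : ℝ) * I)‖ₑ ^ P ≤ ⨆ n, v n x ^ 2 := by
        refine le_trans ?_ (le_iSup _ n)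
        rw [← hsq]
        exact pow_le_pow_left' ((h n x).2 n le_rfl) 2
      calc ‖f (x + (q n : ℝ) * I)‖ₑ = (‖f (x + (q n : ℝ) * I)‖ₑ ^ P) ^ (1 / P) := by
            rw [← ENNReal.rpow_mul, mul_one_div_cancel hP0.ne', ENNReal.rpow_one]
        _ ≤ _ := ENNReal.rpow_le_rpow h1 (by positivity)
    have := hcl (Real.log y)
    rwa [Real.exp_log hy] at this


lemma hh_scale (t : ℝ) (ht : 0 < t) (g : ℝ → ℝ≥0∞) (hg : Measurable g) :
    ∫⁻ x, g (x / t) = ENNReal.ofReal t * ∫⁻ x, g x := by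
  have h := Real.map_volume_mul_right (inv_ne_zero ht.ne')
  rw [inv_inv, abs_of_pos ht] at h
  rw [← smul_eq_mul, ← lintegral_smul_measure, ← h,
    lintegral_map hg (measurable_mul_const t⁻¹)]
  simp_rw [div_eq_mul_inv]

lemma hh_dom (p : ℝ≥0∞) (hp : 1 ≤ p) (f : ℂ → ℂ) (hf : MemHardy p f) :
    ∃ N : ℝ → ℝ≥0∞, Measurable N ∧ (∀ x y : ℝ, 0 < y → ‖f (x + y * I)‖ₑ ≤ N x) ∧
      ∀ R : ℝ, ∃ C : ℝ≥0∞, C ≠ ⊤ ∧ ∀ t : ℝ, 0 < t →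
        ∫⁻ x in Icc (-R) R, N (x / t) ≤ C * ENNReal.ofReal (t ^ (1 / p).toReal) := by
  obtain ⟨hd, hfin⟩ := hf
  have hle : ∀ y : ℝ, 0 < y → eLpNorm (fun x : ℝ => f (x + y * Complex.I)) p volume ≤
      hardyNorm p f := fun y hy =>
    le_iSup₂ (f := fun (y : ℝ) (_ : y ∈ Set.Ioi (0 : ℝ)) =>
      eLpNorm (fun x : ℝ => f (x + y * Complex.I)) p volume) y hy
  set K := hardyNorm p f with hK
  have hlc : ∀ y : ℝ, 0 < y → Continuous (fun x : ℝ => f (x + y * I)) := by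
    intro y hy
    refine hd.continuousOn.comp_continuous (f := fun x : ℝ => (x + y * I : ℂ)) (by fun_prop) ?_
    intro x
    simpa using hy
  by_cases hpt : p = ⊤
  · subst hpt
    refine ⟨fun _ => K, measurable_const, ?_, ?_⟩
    · intro x y hy
      have h1 := hle y hy
      rw [eLpNorm_exponent_top] at h1
      have h2 : ∀ᵐ x : ℝ, ‖f (x + y * I)‖ₑ ≤ K := by
        filter_upwards [enorm_ae_le_eLpNormEssSup (fun x : ℝ => f (x + y * Complex.I)) volume]
          with x hx using hx.trans h1
      have h3 : Dense {x : ℝ | ‖f (x + y * I)‖ₑ ≤ K} := Measure.dense_of_ae h2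
      have h4 : IsClosed {x : ℝ | ‖f (x + y * I)‖ₑ ≤ K} :=
        isClosed_le (hlc y hy).enorm continuous_const
      have h5 := h3 x
      rwa [h4.closure_eq] at h5
    · intro R
      refine ⟨K * volume (Icc (-R) R), ENNReal.mul_ne_top hfin.ne (by simp), fun t ht => ?_⟩
      simp
  · have hp0 : p ≠ 0 := (one_pos.trans_le hp).ne'
    set P := p.toReal with hPdef
    have hP : 1 ≤ P := by
      rw [hPdef]
      simpa using ENNReal.toReal_mono hpt hp
    have hP0 : 0 < P := by linarith
    obtain ⟨N, hN, hNi, hNb⟩ := hh_maximal f hd P hP (K ^ P)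
      (ENNReal.rpow_ne_top_of_nonneg hP0.le hfin.ne) (by
        intro y hy
        have h1 := hle y hy
        rw [eLpNorm_eq_lintegral_rpow_enorm_toReal hp0 hpt] at h1
        have h2 := ENNReal.rpow_le_rpow h1 hP0.le
        rwa [← ENNReal.rpow_mul, one_div_mul_cancel hP0.ne', ENNReal.rpow_one] at h2)
    refine ⟨N, hN, hNb, fun R => ⟨volume (Icc (-R) R) + ∫⁻ x, N x ^ P, ?_, ?_⟩⟩
    · refine ENNReal.add_ne_top.mpr ⟨by simp, ne_top_of_le_ne_top ?_ hNi⟩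
      exact ENNReal.mul_ne_top (by simp) (ENNReal.rpow_ne_top_of_nonneg hP0.le hfin.ne)
    · intro t ht
      have he : (1 / p).toReal = 1 / P := by simp [hPdef]
      rw [he]
      set T := ENNReal.ofReal (t ^ (1 / P)) with hT
      have hTp : 0 < t ^ (1 / P) := Real.rpow_pos_of_pos ht _
      have hT0 : T ≠ 0 := by simpa [hT] using hTp
      have hTt : T ≠ ⊤ := ENNReal.ofReal_ne_top
      have hTP : T ^ P = ENNReal.ofReal t := by
        rw [hT, ENNReal.ofReal_rpow_of_pos hTp, ← Real.rpow_mul ht.le,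
          one_div_mul_cancel hP0.ne', Real.rpow_one]
      have ht0 : ENNReal.ofReal t ≠ 0 := by simpa using ht
      have hpt : ∀ n : ℝ≥0∞, n ≤ T * (1 + n ^ P / ENNReal.ofReal t) := by
        intro n
        rw [← hTP, ← ENNReal.div_rpow_of_nonneg _ _ hP0.le]
        have hn : n = T * (n / T) := (ENNReal.mul_div_cancel hT0 hTt).symm
        conv_lhs => rw [hn]
        gcongr
        rcases le_total (n / T) 1 with h | h
        · exact h.trans le_self_add
        · refine le_trans ?_ le_add_self
          conv_lhs => rw [← ENNReal.rpow_one (n / T)]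
          exact ENNReal.rpow_le_rpow_of_exponent_le h hP
      calc ∫⁻ x in Icc (-R) R, N (x / t)
          ≤ ∫⁻ x in Icc (-R) R, T * (1 + N (x / t) ^ P / ENNReal.ofReal t) :=
            lintegral_mono fun x => hpt _
        _ = T * (volume (Icc (-R) R) + ∫⁻ x in Icc (-R) R, N (x / t) ^ P / ENNReal.ofReal t) := by
            rw [lintegral_const_mul' _ _ hTt, lintegral_add_left measurable_const]
            simp
        _ ≤ T * (volume (Icc (-R) R) + ∫⁻ x, N (x / t) ^ P / ENNReal.ofReal t) := by
            gcongr
            exact Measure.restrict_le_self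
        _ = T * (volume (Icc (-R) R) + ∫⁻ x, N x ^ P) := by
            congr 2
            simp_rw [div_eq_mul_inv (_ ^ P)]
            rw [lintegral_mul_const' _ _ (ENNReal.inv_ne_top.mpr ht0),
              hh_scale t ht (fun x => N x ^ P) (hN.pow_const _), mul_comm, ← mul_assoc,
              ENNReal.inv_mul_cancel ht0 ENNReal.ofReal_ne_top, one_mul]
        _ = _ := mul_comm _ _

/-- The boundary value function of `𝓗_φ f` is `H_φ (f*)`: if `f ∈ H_a^p(ℂ₊)` has
a.e. boundary values `f*`, then for a.e. `x`, `𝓗_φ f (x+iy) → ∫₀^∞ f*(x/t) φ(t)/t dt`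
as `y → 0⁺`. -/
theorem boundary_value_hausdorff (p : ℝ≥0∞) (hp : 1 ≤ p)
    (φ : ℝ → ℝ) (hφ : ∀ t, 0 ≤ φ t)
    (hloc : LocallyIntegrableOn φ (Set.Ioi 0))
    (hint : IntegrableOn (fun t : ℝ => t ^ ((1 / p).toReal - 1) * φ t) (Set.Ioi 0))
    (f : ℂ → ℂ) (hf : MemHardy p f) (fstar : ℝ → ℂ)
    (hfstar : ∀ᵐ x : ℝ, Tendsto (fun y : ℝ => f (x + y * Complex.I))
      (𝓝[>] (0 : ℝ)) (𝓝 (fstar x))) :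
    ∀ᵐ x : ℝ, Tendsto (fun y : ℝ => hausdorffC φ f (x + y * Complex.I))
      (𝓝[>] (0 : ℝ)) (𝓝 (∫ t in Set.Ioi (0 : ℝ), (φ t / t) • fstar (x / t))) := by
  obtain ⟨N, hN, hNb, hNR⟩ := hh_dom p hp f hf
  have hφm : AEStronglyMeasurable φ (volume.restrict (Ioi 0)) := hloc.aestronglyMeasurable
  have hφt : AEStronglyMeasurable (fun t => φ t / t) (volume.restrict (Ioi 0)) :=
    (hφm.aemeasurable.div measurable_id.aemeasurable).aestronglyMeasurable
  set ψ : ℝ → ℝ≥0∞ := fun t => ENNReal.ofReal (φ t / t) with hψ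
  have hψm : AEMeasurable ψ (volume.restrict (Ioi 0)) := hφt.aemeasurable.ennreal_ofReal
  have hjoint : ∀ ν : Measure ℝ, SFinite ν → AEMeasurable (fun z : ℝ × ℝ => ψ z.2 * N (z.1 / z.2))
      (ν.prod (volume.restrict (Ioi 0))) := by
    intro ν _
    exact hψm.comp_snd.mul (hN.comp (measurable_fst.div measurable_snd)).aemeasurable
  -- the dominating function is integrable for almost every point
  have hA : ∀ᵐ x : ℝ, ∫⁻ t in Ioi (0:ℝ), ψ t * N (x / t) < ⊤ := by
    have hn : ∀ n : ℕ, ∀ᵐ x : ℝ, x ∈ Icc (-(n:ℝ)) n → ∫⁻ t in Ioi (0:ℝ), ψ t * N (x / t) < ⊤ := by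
      intro n
      rw [← ae_restrict_iff' measurableSet_Icc]
      obtain ⟨C, hC, hCt⟩ := hNR n
      refine ae_lt_top' (hjoint _ inferInstance).lintegral_prod_right' ?_
      rw [lintegral_lintegral_swap (hjoint _ inferInstance)]
      have hle : ∫⁻ t in Ioi (0:ℝ), ∫⁻ x in Icc (-(n:ℝ)) n, ψ t * N (x / t) ≤
          ∫⁻ t in Ioi (0:ℝ), C * ENNReal.ofReal (t ^ ((1 / p).toReal - 1) * φ t) := by
        apply setLIntegral_mono' measurableSet_Ioi
        intro t ht
        have ht : 0 < t := ht
        rw [lintegral_const_mul' _ _ ENNReal.ofReal_ne_top]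
        calc _ ≤ ψ t * (C * ENNReal.ofReal (t ^ (1 / p).toReal)) := by
              gcongr
              exact hCt t ht
          _ = C * (ENNReal.ofReal (t ^ (1 / p).toReal) * ψ t) := by ring
          _ = _ := by
              rw [hψ, ← ENNReal.ofReal_mul (by positivity), Real.rpow_sub_one ht.ne']
              congr 2
              ring
      refine ne_top_of_le_ne_top ?_ hle
      rw [lintegral_const_mul' _ _ hC]
      refine ENNReal.mul_ne_top hC ?_
      exact hint.lintegral_lt_top.ne
    filter_upwards [ae_all_iff.mpr hn] with x hx
    obtain ⟨n, hn⟩ := exists_nat_ge |x|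
    exact hx n (abs_le.mp hn)
  -- for almost every `x`, almost every `x / t` is a good point
  have hG : ∀ᵐ x : ℝ, ∀ᵐ t ∂(volume.restrict (Ioi (0:ℝ))),
      Tendsto (fun y : ℝ => f ((x / t : ℝ) + y * I)) (𝓝[>] (0 : ℝ)) (𝓝 (fstar (x / t))) := by
    set E := {x : ℝ | ¬ Tendsto (fun y : ℝ => f (x + y * I)) (𝓝[>] (0 : ℝ)) (𝓝 (fstar x))} with hE
    have hE0 : volume E = 0 := hfstar
    have hE' : volume (toMeasurable volume E) = 0 := by rw [measure_toMeasurable, hE0]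
    have hm : MeasurableSet (toMeasurable volume E) := measurableSet_toMeasurable _ _
    have : ∀ᵐ x : ℝ, ∀ᵐ t ∂(volume.restrict (Ioi (0:ℝ))), x / t ∉ toMeasurable volume E := by
      rw [Measure.ae_ae_comm]
      · refine (ae_restrict_iff' measurableSet_Ioi).mpr (Eventually.of_forall fun t ht => ?_)
        have h1 := hh_scale t ht (indicator (toMeasurable volume E) 1)
          (measurable_one.indicator hm)
        have hm1 : Measurable (fun x : ℝ =>
            (toMeasurable volume E).indicator (1 : ℝ → ℝ≥0∞) (x / t)) :=
          (measurable_one.indicator hm).comp (measurable_id.div_const t)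
        rw [lintegral_indicator_one hm, hE', mul_zero, lintegral_eq_zero_iff hm1] at h1
        filter_upwards [h1] with x hx hxE
        simp [indicator_of_mem hxE] at hx
      · exact (hm.preimage (measurable_fst.div measurable_snd)).compl
    filter_upwards [this] with x hx
    filter_upwards [hx] with t ht
    by_contra hcon
    exact ht (subset_toMeasurable volume E hcon)
  filter_upwards [hA, hG] with x hxA hxG
  have hxm : AEMeasurable (fun t => ψ t * N (x / t)) (volume.restrict (Ioi 0)) :=
    hψm.mul (hN.comp (measurable_const.div measurable_id)).aemeasurable
  have hdiv : ∀ y t : ℝ, ((x : ℂ) + y * I) / t = ((x / t : ℝ) : ℂ) + (y / t : ℝ) * I := by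
    intro y t
    push_cast
    ring
  unfold hausdorffC
  refine tendsto_integral_filter_of_dominated_convergence
    (fun t => (ψ t * N (x / t)).toReal) ?_ ?_ ?_ ?_
  · filter_upwards [self_mem_nhdsWithin] with y hy
    have hy : 0 < y := hy
    refine hφt.smul ?_
    refine ContinuousOn.aestronglyMeasurable ?_ measurableSet_Ioi
    refine hf.1.continuousOn.comp ?_ ?_
    · refine ContinuousOn.div continuousOn_const (by fun_prop) ?_
      intro t ht
      exact_mod_cast (ne_of_gt ht)
    · intro t ht
      have ht : 0 < t := ht
      simp only [mem_ofPred_eq, hdiv]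
      simp
      positivity
  · filter_upwards [self_mem_nhdsWithin] with y hy
    have hy : 0 < y := hy
    filter_upwards [ae_lt_top' hxm hxA.ne, ae_restrict_mem measurableSet_Ioi] with t h1 ht
    have ht : 0 < t := ht
    rw [← toReal_enorm]
    refine ENNReal.toReal_mono h1.ne ?_
    rw [enorm_smul, hdiv]
    gcongr
    · rw [hψ, Real.enorm_of_nonneg (div_nonneg (hφ t) ht.le)]
    · exact hNb _ _ (by positivity)
  · exact integrable_toReal_of_lintegral_ne_top hxm hxA.ne
  · filter_upwards [hxG, ae_restrict_mem measurableSet_Ioi] with t h1 ht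
    have ht : 0 < t := ht
    refine Tendsto.const_smul ?_ _
    simp_rw [hdiv]
    have hlim : Tendsto (fun y : ℝ => y / t) (𝓝[>] 0) (𝓝[>] 0) := by
      refine tendsto_nhdsWithin_iff.mpr ⟨?_, ?_⟩
      · have : Tendsto (fun y : ℝ => y / t) (𝓝 0) (𝓝 (0 / t)) := tendsto_id.div_const t
        rw [zero_div] at this
        exact this.mono_left nhdsWithin_le_nhds
      · filter_upwards [self_mem_nhdsWithin] with y hy
        exact div_pos hy ht
    exact h1.comp hlim
end

section
/- Let p ∈ [1,∞) and let φ be a nonnegative function in L¹_loc(0,∞) with ∫₀^∞ t^{1/p−1} φ(t) dt < ∞. Then 𝓗_φ is bounded on H_a^p(ℂ₊) and ‖𝓗_φ‖_{H_a^p(ℂ₊) → H_a^p(ℂ₊)} ≤ ∫₀^∞ t^{1/p−1} φ(t) dt. -/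
open MeasureTheory Complex Filter Set Topology ENNReal NNReal

lemma aux_circle (g : ℂ → ℂ) (c : ℂ) (r : ℝ) (hr : 0 < r)
    (hg : DifferentiableOn ℂ g {z : ℂ | 0 < z.im}) (hc : r < c.im) :
    ENNReal.ofReal (2 * Real.pi) * ‖g c‖ₑ ≤
      ∫⁻ θ in Ioo (-Real.pi) Real.pi, ‖g (circleMap c r θ)‖ₑ := by
  have hsub : closure (Metric.ball c |r|) ⊆ {z : ℂ | 0 < z.im} := by
    intro w hw
    have hw' := Metric.closure_ball_subset_closedBall hw
    rw [Metric.mem_closedBall, dist_eq_norm, abs_of_pos hr] at hw'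
    have h1 := Complex.abs_im_le_norm (w - c)
    rw [Complex.sub_im] at h1
    have h2 := neg_abs_le (w.im - c.im)
    simp only [mem_ofPred_eq]
    linarith
  have h := (DifferentiableOn.diffContOnCl (hg.mono hsub)).circleAverage
  have hper : Function.Periodic (fun θ => g (circleMap c r θ)) (2 * Real.pi) := fun θ => by
    simp only [(periodic_circleMap c r) θ]
  have h3 := hper.intervalIntegral_add_eq 0 (-Real.pi)
  rw [Real.circleAverage] at h
  rw [zero_add] at h3
  rw [h3, show -Real.pi + 2 * Real.pi = Real.pi by ring,
    intervalIntegral.integral_of_le (by linarith [Real.pi_pos]), integral_Ioc_eq_integral_Ioo] at h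
  have h4 : (2 * Real.pi) • g c = ∫ θ in Ioo (-Real.pi) Real.pi, g (circleMap c r θ) := by
    rw [← h, smul_smul, mul_inv_cancel₀ (by positivity), one_smul]
  have h5 := enorm_integral_le_lintegral_enorm (μ := volume.restrict (Ioo (-Real.pi) Real.pi))
    (fun θ => g (circleMap c r θ))
  rw [← h4, enorm_smul, Real.enorm_eq_ofReal (by positivity)] at h5
  exact h5

lemma aux_area (g : ℂ → ℂ) (gm : Measurable g) (c : ℂ) (R : ℝ) (hR : 0 < R)
    (hg : DifferentiableOn ℂ g {z : ℂ | 0 < z.im}) (hc : R ≤ c.im) :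
    ENNReal.ofReal (R / 2) * (ENNReal.ofReal (R / 2) * (ENNReal.ofReal (2 * Real.pi) * ‖g c‖ₑ)) ≤
      ∫⁻ w in Metric.ball c R, ‖g w‖ₑ := by
  have h1 : ∫⁻ w in Metric.ball c R, ‖g w‖ₑ =
      ∫⁻ w, (Metric.ball c R).indicator (fun w => ‖g w‖ₑ) (c + w) := by
    rw [lintegral_add_left_eq_self (fun w => (Metric.ball c R).indicator (fun w => ‖g w‖ₑ) w) c,
      lintegral_indicator Metric.isOpen_ball.measurableSet]
  rw [h1, ← Complex.lintegral_comp_polarCoord_symm]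
  have hsub : Ioo (R/2) R ×ˢ Ioo (-Real.pi) Real.pi ⊆ polarCoord.target := by
    rw [polarCoord_target]
    exact prod_mono (fun r hr => by simp only [mem_Ioi]; linarith [hr.1]) le_rfl
  refine le_trans ?_ (lintegral_mono_set hsub)
  have key : ∫⁻ p in Ioo (R/2) R ×ˢ Ioo (-Real.pi) Real.pi,
      ENNReal.ofReal (R/2) * ‖g (circleMap c p.1 p.2)‖ₑ ≤
      ∫⁻ p in Ioo (R/2) R ×ˢ Ioo (-Real.pi) Real.pi, ENNReal.ofReal p.1 •
        (Metric.ball c R).indicator (fun w => ‖g w‖ₑ) (c + Complex.polarCoord.symm p) := by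
    refine setLIntegral_mono' (measurableSet_Ioo.prod measurableSet_Ioo) ?_
    rintro ⟨r, θ⟩ ⟨⟨h1, h2⟩, -⟩
    simp only at h1 h2
    have e : c + Complex.polarCoord.symm (r, θ) = circleMap c r θ := by
      rw [Complex.polarCoord_symm_apply, circleMap, Complex.exp_mul_I]
      push_cast; rfl
    have hm : circleMap c r θ ∈ Metric.ball c R := by
      rw [Metric.mem_ball, dist_eq_norm, circleMap_sub_center, norm_circleMap_zero,
        abs_of_pos (by linarith)]
      exact h2
    rw [e, indicator_of_mem hm, smul_eq_mul]
    gcongr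
  refine le_trans ?_ key
  have hmeas : Measurable (fun p : ℝ × ℝ => ‖g (circleMap c p.1 p.2)‖ₑ) := by
    apply Measurable.enorm
    apply gm.comp
    unfold circleMap
    fun_prop
  rw [lintegral_const_mul _ hmeas]
  gcongr
  rw [Measure.volume_eq_prod, setLIntegral_prod _ hmeas.aemeasurable]
  have : ∫⁻ r in Ioo (R/2) R, ENNReal.ofReal (2 * Real.pi) * ‖g c‖ₑ =
      ENNReal.ofReal (R / 2) * (ENNReal.ofReal (2 * Real.pi) * ‖g c‖ₑ) := by
    rw [setLIntegral_const, Real.volume_Ioo, mul_comm, show R - R/2 = R/2 by ring]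
  rw [← this]
  refine setLIntegral_mono' measurableSet_Ioo ?_
  rintro r ⟨h1, h2⟩
  exact aux_circle g c r (by linarith) hg (by linarith)

lemma aux_point (p : ℝ≥0∞) (hp : 1 ≤ p) (hptop : p ≠ ⊤) (g : ℂ → ℂ) (gm : Measurable g)
    (hg : DifferentiableOn ℂ g {z : ℂ | 0 < z.im}) (M : ℝ≥0∞) (hM : M ≠ ⊤)
    (hb : ∀ y : ℝ, 0 < y → eLpNorm (fun x : ℝ => g (x + y * Complex.I)) p volume ≤ M) :
    ∃ K : ℝ, 0 ≤ K ∧ ∀ z : ℂ, 0 < z.im → ‖g z‖ ≤ K * z.im ^ (-(1 / p).toReal) := by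
  set a := (1 / p).toReal with ha
  refine ⟨16 / (2 * Real.pi) * M.toReal, by positivity, fun z hz => ?_⟩
  set y := z.im with hy
  have h1 := aux_area g gm z (y / 2) (by positivity) hg (by linarith)
  have hsub : Metric.ball z (y/2) ⊆ Complex.measurableEquivRealProd ⁻¹'
      (Ioo (z.re - y/2) (z.re + y/2) ×ˢ Ioo (y - y/2) (y + y/2)) := by
    intro w hw
    rw [Metric.mem_ball, dist_eq_norm] at hw
    have h1 := abs_le.1 (Complex.abs_im_le_norm (w - z))
    have h2 := abs_le.1 (Complex.abs_re_le_norm (w - z))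
    rw [Complex.sub_im, ← hy] at h1
    rw [Complex.sub_re] at h2
    simp only [mem_preimage, Complex.measurableEquivRealProd_apply, mem_prod, mem_Ioo]
    refine ⟨⟨?_, ?_⟩, ?_, ?_⟩ <;> linarith
  have h2 := h1.trans (lintegral_mono_set hsub)
  have h3 : ∫⁻ w in Complex.measurableEquivRealProd ⁻¹'
      (Ioo (z.re - y/2) (z.re + y/2) ×ˢ Ioo (y - y/2) (y + y/2)), ‖g w‖ₑ =
      ∫⁻ v in Ioo (y - y/2) (y + y/2), ∫⁻ u in Ioo (z.re - y/2) (z.re + y/2),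
        ‖g (u + v * Complex.I)‖ₑ := by
    have hm : Measurable (fun q : ℝ × ℝ => ‖g (q.1 + q.2 * Complex.I)‖ₑ) := by
      apply Measurable.enorm
      apply gm.comp
      fun_prop
    have h := (Complex.volume_preserving_equiv_real_prod.setLIntegral_comp_preimage
      (measurableSet_Ioo.prod measurableSet_Ioo) hm
      (s := Ioo (z.re - y/2) (z.re + y/2) ×ˢ Ioo (y - y/2) (y + y/2)))
    simp only [Complex.measurableEquivRealProd_apply, Complex.re_add_im] at h
    rw [h, Measure.volume_eq_prod, ← Measure.prod_restrict,
      lintegral_prod_symm' _ hm]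
  rw [h3] at h2
  have h4 : ∀ v ∈ Ioo (y - y/2) (y + y/2), ∫⁻ u in Ioo (z.re - y/2) (z.re + y/2),
        ‖g (u + v * Complex.I)‖ₑ ≤ M * ENNReal.ofReal y ^ (1 - a) := by
    intro v hv
    have hm : Measurable (fun u : ℝ => g (u + v * Complex.I)) := gm.comp (by fun_prop)
    have := eLpNorm_le_eLpNorm_mul_rpow_measure_univ
      (μ := volume.restrict (Ioo (z.re - y/2) (z.re + y/2))) hp hm.aestronglyMeasurable
    rw [eLpNorm_one_eq_lintegral_enorm, Measure.restrict_apply_univ, Real.volume_Ioo] at this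
    refine this.trans ?_
    have e1 : 1 / (1:ℝ≥0∞).toReal - 1 / p.toReal = 1 - a := by
      rw [ha, ENNReal.toReal_div]; simp
    rw [e1, show z.re + y/2 - (z.re - y/2) = y by ring]
    gcongr
    exact (eLpNorm_mono_measure _ Measure.restrict_le_self).trans (hb v (by linarith [hv.1]))
  have h5 := h2.trans (setLIntegral_mono' measurableSet_Ioo h4)
  rw [setLIntegral_const, Real.volume_Ioo, show y + y/2 - (y - y/2) = y by ring] at h5
  have h6 := ENNReal.toReal_mono (by finiteness) h5
  rw [ENNReal.ofReal_rpow_of_pos hz] at h6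
  simp only [ENNReal.toReal_mul, toReal_enorm] at h6
  rw [ENNReal.toReal_ofReal (by positivity), ENNReal.toReal_ofReal (by positivity),
    ENNReal.toReal_ofReal (by positivity), ENNReal.toReal_ofReal (by positivity),
    Real.rpow_sub hz, Real.rpow_one] at h6
  rw [Real.rpow_neg hz.le]
  have hya : 0 < y ^ a := by positivity
  have h7 : ‖g z‖ * (y^2 * (2 * Real.pi / 16)) ≤
    (16 / (2 * Real.pi) * M.toReal * (y ^ a)⁻¹) * (y^2 * (2 * Real.pi / 16)) := by
    refine le_trans (le_of_eq ?_) (h6.trans (le_of_eq ?_))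
    · ring
    · field_simp
  exact le_of_mul_le_mul_right h7 (by positivity)

lemma aux_diff (a : ℝ) (φ : ℝ → ℝ) (hφ : ∀ t, 0 ≤ φ t)
    (hloc : LocallyIntegrableOn φ (Set.Ioi 0))
    (hint : IntegrableOn (fun t : ℝ => t ^ (a - 1) * φ t) (Set.Ioi 0))
    (g : ℂ → ℂ) (gm : Measurable g) (ha : 0 ≤ a)
    (hg : DifferentiableOn ℂ g {z : ℂ | 0 < z.im}) (K : ℝ) (hK : 0 ≤ K)
    (hb : ∀ z : ℂ, 0 < z.im → ‖g z‖ ≤ K * z.im ^ (-a)) :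
    DifferentiableOn ℂ (hausdorffC φ g) {z : ℂ | 0 < z.im} := by
  intro z0 hz0
  simp only [mem_ofPred_eq] at hz0
  have hopen : IsOpen {z : ℂ | 0 < z.im} := isOpen_lt continuous_const Complex.continuous_im
  have him : ∀ (z : ℂ) (t : ℝ), (z / (t : ℂ)).im = z.im / t := fun z t => by
    rw [Complex.div_ofReal_im]
  have φm : AEStronglyMeasurable φ (volume.restrict (Ioi 0)) :=
    hloc.aestronglyMeasurable
  have hd : ∀ w : ℂ, 0 < w.im → ‖deriv g w‖ ≤ K * (w.im / 2) ^ (-a) / (w.im / 2) := by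
    intro w hw
    have hsub : Metric.closedBall w (w.im / 2) ⊆ {z : ℂ | w.im / 2 ≤ z.im} := by
      intro v hv
      rw [Metric.mem_closedBall, dist_eq_norm] at hv
      have h1 := abs_le.1 (Complex.abs_im_le_norm (v - w))
      rw [Complex.sub_im] at h1
      simp only [mem_ofPred_eq]
      linarith
    have hsub' : Metric.closedBall w (w.im / 2) ⊆ {z : ℂ | 0 < z.im} := by
      intro v hv
      have := hsub hv
      simp only [mem_ofPred_eq] at *
      linarith
    refine Complex.norm_deriv_le_of_forall_mem_sphere_norm_le (by positivity)
      (DifferentiableOn.diffContOnCl (hg.mono (Metric.closure_ball_subset_closedBall.trans hsub')))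
      ?_
    intro v hv
    have hv' := Metric.sphere_subset_closedBall hv
    refine (hb v (hsub' hv')).trans ?_
    have := Real.rpow_le_rpow_of_nonpos (by positivity) (hsub hv') (neg_nonpos.2 ha)
    gcongr
  have hmF : ∀ z : ℂ, AEStronglyMeasurable (fun t : ℝ => (φ t / t) • g (z / (t : ℂ)))
      (volume.restrict (Ioi 0)) := by
    intro z
    refine AEStronglyMeasurable.smul (f := fun t : ℝ => φ t / t) (g := fun t : ℝ => g (z / (t:ℂ))) ?_ ?_
    · exact (φm.aemeasurable.div aemeasurable_id).aestronglyMeasurable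
    · exact (gm.comp (by fun_prop)).aestronglyMeasurable
  have key := hasDerivAt_integral_of_dominated_loc_of_deriv_le
    (μ := volume.restrict (Ioi (0:ℝ))) (𝕜 := ℂ) (x₀ := z0)
    (s := {z : ℂ | z0.im / 2 < z.im})
    (F := fun z t => (φ t / t) • g (z / (t : ℂ)))
    (F' := fun z t => (φ t / t) • (deriv g (z / (t : ℂ)) / (t:ℂ)))
    (bound := fun t => (K * (z0.im / 4) ^ (-a) / (z0.im / 4)) * (t ^ (a - 1) * φ t))
    ?_ ?_ ?_ ?_ ?_ ?_ ?_
  · exact key.2.differentiableAt.differentiableWithinAt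
  · exact (isOpen_lt continuous_const Complex.continuous_im).mem_nhds (by
      simp only [mem_ofPred_eq]; linarith)
  · exact Eventually.of_forall hmF
  · refine Integrable.mono' (hint.const_mul (K * z0.im ^ (-a))) (hmF z0) ?_
    filter_upwards [ae_restrict_mem measurableSet_Ioi] with t ht
    simp only [mem_Ioi] at ht
    have h1 := hb (z0 / (t:ℂ)) (by rw [him]; positivity)
    rw [him, Real.div_rpow hz0.le ht.le, Real.rpow_neg ht.le, div_inv_eq_mul] at h1
    rw [norm_smul, Real.norm_of_nonneg (div_nonneg (hφ t) ht.le), Real.rpow_sub ht, Real.rpow_one]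
    have := mul_le_mul_of_nonneg_left h1 (div_nonneg (hφ t) ht.le)
    refine this.trans (le_of_eq ?_)
    ring
  · refine AEStronglyMeasurable.smul (f := fun t : ℝ => φ t / t)
      (g := fun t : ℝ => deriv g (z0 / (t:ℂ)) / (t:ℂ)) ?_ ?_
    · exact (φm.aemeasurable.div aemeasurable_id).aestronglyMeasurable
    · exact (((measurable_deriv g).comp (by fun_prop)).div (by fun_prop)).aestronglyMeasurable
  · filter_upwards [ae_restrict_mem measurableSet_Ioi] with t ht z hz
    simp only [mem_Ioi, mem_ofPred_eq] at ht hz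
    have hz' : 0 < z.im := by linarith
    have h1 := hd (z / (t:ℂ)) (by rw [him]; positivity)
    rw [him] at h1
    have hle : z0.im / 4 / t ≤ z.im / t / 2 := by
      rw [div_right_comm z.im]; gcongr ?_ / t; linarith
    have h2 : K * (z.im / t / 2) ^ (-a) / (z.im / t / 2) ≤
        K * (z0.im / 4 / t) ^ (-a) / (z0.im / 4 / t) := by
      have := Real.rpow_le_rpow_of_nonpos (by positivity) hle (neg_nonpos.2 ha)
      gcongr
    have h3 := h1.trans h2
    rw [Real.div_rpow (by positivity) ht.le, Real.rpow_neg ht.le, div_inv_eq_mul] at h3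
    rw [norm_smul, Real.norm_of_nonneg (div_nonneg (hφ t) ht.le), norm_div, Complex.norm_real,
      Real.norm_of_nonneg ht.le, Real.rpow_sub ht, Real.rpow_one]
    have h4 : ‖deriv g (z / (t:ℂ))‖ / t ≤
        K * ((z0.im / 4) ^ (-a) * t ^ a) / (z0.im / 4 / t) / t := by gcongr
    have := mul_le_mul_of_nonneg_left h4 (div_nonneg (hφ t) ht.le)
    refine this.trans (le_of_eq ?_)
    field_simp
  · exact hint.const_mul _
  · filter_upwards [ae_restrict_mem measurableSet_Ioi] with t ht z hz
    simp only [mem_Ioi, mem_ofPred_eq] at ht hz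
    have hz' : 0 < (z / (t:ℂ)).im := by rw [him]; exact div_pos (by linarith) ht
    have h1 := ((hg.differentiableAt (hopen.mem_nhds hz')).hasDerivAt)
    have h2 := h1.comp z ((hasDerivAt_id z).div_const (t:ℂ))
    have h3 := h2.const_smul (φ t / t)
    rw [mul_one_div] at h3
    exact h3

lemma aux_norm (p : ℝ≥0∞) (hp : 1 ≤ p) (hptop : p ≠ ⊤)
    (φ : ℝ → ℝ) (hφ : ∀ t, 0 ≤ φ t)
    (hint : IntegrableOn (fun t : ℝ => t ^ ((1 / p).toReal - 1) * φ t) (Set.Ioi 0))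
    (g : ℂ → ℂ) (gm : Measurable g) (M : ℝ≥0∞)
    (hb : ∀ y : ℝ, 0 < y → eLpNorm (fun x : ℝ => g (x + y * Complex.I)) p volume ≤ M)
    (y : ℝ) (hy : 0 < y) :
    eLpNorm (fun x : ℝ => hausdorffC φ g (x + y * Complex.I)) p volume ≤
      ENNReal.ofReal (∫ t in Set.Ioi (0 : ℝ), t ^ ((1 / p).toReal - 1) * φ t) * M := by
  have hp0 : p ≠ 0 := (zero_lt_one.trans_le hp).ne'
  have hq : 0 < p.toReal := ENNReal.toReal_pos hp0 hptop
  have ha : (1 / p).toReal = 1 / p.toReal := by rw [ENNReal.toReal_div]; simp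
  rw [ha] at hint ⊢
  set q := p.toReal with hqdef
  have hq1 : 1 ≤ q := by
    have := ENNReal.toReal_mono hptop hp
    simpa using this
  set w : ℝ → ℝ≥0∞ := fun t => ENNReal.ofReal (t ^ (1 / q - 1) * φ t) with hw
  have wm : AEMeasurable w (volume.restrict (Ioi 0)) := hint.aestronglyMeasurable.aemeasurable.ennreal_ofReal
  set ν := (volume.restrict (Ioi (0:ℝ))).withDensity w with hν
  have hνu : ν univ = ENNReal.ofReal (∫ t in Set.Ioi (0 : ℝ), t ^ (1 / q - 1) * φ t) := by
    rw [ofReal_integral_eq_lintegral_ofReal hint, hν, withDensity_apply _ MeasurableSet.univ,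
      Measure.restrict_univ]
    filter_upwards [ae_restrict_mem measurableSet_Ioi] with t ht
    exact mul_nonneg (Real.rpow_nonneg (le_of_lt ht) _) (hφ t)
  rw [← hνu]
  have hνfin : ν univ ≠ ⊤ := by rw [hνu]; finiteness
  set G : ℝ → ℝ → ℝ≥0∞ := fun x t =>
    ‖t ^ (-(1 / q))‖ₑ * ‖g ((x + y * Complex.I) / (t : ℂ))‖ₑ with hG
  have Gm : Measurable (Function.uncurry G) := by
    refine Measurable.mul (f := fun z : ℝ × ℝ => ‖z.2 ^ (-(1 / q))‖ₑ)
      (g := fun z : ℝ × ℝ => ‖g ((z.1 + y * Complex.I) / (z.2 : ℂ))‖ₑ) ?_ ?_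
    · apply Measurable.enorm
      fun_prop
    · apply Measurable.enorm
      exact gm.comp (by fun_prop)
  have Gx : ∀ x, Measurable (G x) := fun x => Gm.comp measurable_prodMk_left
  have hpt : ∀ x : ℝ, ‖hausdorffC φ g (x + y * Complex.I)‖ₑ ≤ ∫⁻ t, G x t ∂ν := by
    intro x
    rw [hν, lintegral_withDensity_eq_lintegral_mul₀ wm (Gx x).aemeasurable]
    refine (enorm_integral_le_lintegral_enorm _).trans ?_
    refine setLIntegral_mono' measurableSet_Ioi fun t ht => ?_
    simp only [mem_Ioi] at ht
    rw [enorm_smul, Pi.mul_apply, hG, ← mul_assoc]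
    gcongr
    rw [hw, Real.enorm_eq_ofReal (div_nonneg (hφ t) ht.le), Real.enorm_eq_ofReal (by positivity),
      ← ENNReal.ofReal_mul (mul_nonneg (by positivity) (hφ t))]
    apply le_of_eq
    congr 1
    rw [mul_right_comm, ← Real.rpow_add ht, show 1 / q - 1 + -(1/q) = -1 by ring, Real.rpow_neg_one]
    ring
  have hpt2 : ∀ x : ℝ, ‖hausdorffC φ g (x + y * Complex.I)‖ₑ ^ q ≤
      ν univ ^ (q - 1) * ∫⁻ t, G x t ^ q ∂ν := by
    intro x
    have h1 := eLpNorm_le_eLpNorm_mul_rpow_measure_univ (μ := ν) hp (Gx x).aestronglyMeasurable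
    rw [eLpNorm_one_eq_lintegral_enorm, eLpNorm_eq_lintegral_rpow_enorm_toReal hp0 hptop] at h1
    simp only [enorm_eq_self] at h1
    have h2 := ENNReal.rpow_le_rpow ((hpt x).trans h1) hq.le
    refine h2.trans (le_of_eq ?_)
    rw [ENNReal.mul_rpow_of_nonneg _ _ hq.le, ← ENNReal.rpow_mul, ← ENNReal.rpow_mul, ← hqdef,
      one_div_mul_cancel hq.ne', ENNReal.rpow_one, mul_comm]
    congr 2
    simp only [ENNReal.toReal_one]
    field_simp
  have hin : ∀ t : ℝ, 0 < t → ∫⁻ x, G x t ^ q ≤ M ^ q := by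
    intro t ht
    have h1 := hb (y / t) (by positivity)
    rw [eLpNorm_eq_lintegral_rpow_enorm_toReal hp0 hptop, ← hqdef, one_div,
      ENNReal.rpow_inv_le_iff hq] at h1
    refine le_trans (le_of_eq ?_) h1
    have hmg : Measurable (fun u : ℝ => ‖g (u + (y / t : ℝ) * Complex.I)‖ₑ ^ q) := by
      apply Measurable.pow_const
      apply Measurable.enorm
      exact gm.comp (by fun_prop)
    have h2 : ∫⁻ x : ℝ, ‖g ((t⁻¹ * x : ℝ) + (y / t : ℝ) * Complex.I)‖ₑ ^ q =
        ENNReal.ofReal t * ∫⁻ u : ℝ, ‖g (u + (y / t : ℝ) * Complex.I)‖ₑ ^ q := by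
      have := lintegral_map (μ := volume) hmg (measurable_const_mul t⁻¹)
      rw [Real.map_volume_mul_left (inv_ne_zero ht.ne'), lintegral_smul_measure, inv_inv,
        abs_of_pos ht] at this
      rw [← this, smul_eq_mul]
    have h3 : ∀ x : ℝ, G x t ^ q = ENNReal.ofReal t⁻¹ *
        ‖g ((t⁻¹ * x : ℝ) + (y / t : ℝ) * Complex.I)‖ₑ ^ q := by
      intro x
      rw [hG]
      simp only
      rw [ENNReal.mul_rpow_of_nonneg _ _ hq.le]
      congr 1
      · rw [Real.enorm_eq_ofReal (by positivity), ENNReal.ofReal_rpow_of_pos (by positivity),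
          ← Real.rpow_mul ht.le, neg_mul, one_div_mul_cancel hq.ne', Real.rpow_neg_one]
      · congr 3
        push_cast
        field_simp
    simp_rw [h3]
    rw [lintegral_const_mul' _ _ (by finiteness), h2, ← mul_assoc, ← ENNReal.ofReal_mul (by positivity),
      inv_mul_cancel₀ ht.ne', ENNReal.ofReal_one, one_mul]
  have hνae : ∀ᵐ t ∂ν, 0 < t :=
    (withDensity_absolutelyContinuous _ _).ae_le (ae_restrict_mem measurableSet_Ioi)
  rw [eLpNorm_eq_lintegral_rpow_enorm_toReal hp0 hptop, ← hqdef, one_div,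
      ENNReal.rpow_inv_le_iff hq]
  calc ∫⁻ x : ℝ, ‖hausdorffC φ g (x + y * Complex.I)‖ₑ ^ q
      ≤ ∫⁻ x : ℝ, ν univ ^ (q - 1) * ∫⁻ t, G x t ^ q ∂ν := lintegral_mono hpt2
    _ = ν univ ^ (q - 1) * ∫⁻ x : ℝ, ∫⁻ t, G x t ^ q ∂ν := by
        rw [lintegral_const_mul' _ _ (ENNReal.rpow_ne_top_of_nonneg (by linarith) hνfin)]
    _ = ν univ ^ (q - 1) * ∫⁻ t, (∫⁻ x : ℝ, G x t ^ q) ∂ν := by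
        rw [lintegral_lintegral_swap (Gm.pow_const q).aemeasurable]
    _ ≤ ν univ ^ (q - 1) * ∫⁻ t, M ^ q ∂ν := by
        gcongr 1
        refine lintegral_mono_ae ?_
        filter_upwards [hνae] with t ht using hin t ht
    _ = (ν univ * M) ^ q := by
        rw [lintegral_const, ENNReal.mul_rpow_of_nonneg _ _ hq.le, mul_comm (M ^ q), ← mul_assoc]
        congr 1
        nth_rewrite 2 [← ENNReal.rpow_one (ν univ)]
        rw [← ENNReal.rpow_add_of_nonneg _ _ (by linarith) (by linarith)]
        congr 1; ring

/-- Lemma 2.3(i): for `p ∈ [1,∞)` and `∫₀^∞ t^{1/p-1} φ(t) dt < ∞`, the operator `𝓗_φ`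
is bounded on `H_a^p(ℂ₊)` with norm at most `∫₀^∞ t^{1/p-1} φ(t) dt`. -/
theorem hausdorff_hardy_norm_le (p : ℝ≥0∞) (hp : 1 ≤ p) (hptop : p ≠ ⊤)
    (φ : ℝ → ℝ) (hφ : ∀ t, 0 ≤ φ t)
    (hloc : LocallyIntegrableOn φ (Set.Ioi 0))
    (hint : IntegrableOn (fun t : ℝ => t ^ ((1 / p).toReal - 1) * φ t) (Set.Ioi 0)) :
    ∀ f : ℂ → ℂ, MemHardy p f →
      MemHardy p (hausdorffC φ f) ∧
      hardyNorm p (hausdorffC φ f) ≤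
        ENNReal.ofReal (∫ t in Set.Ioi (0 : ℝ), t ^ ((1 / p).toReal - 1) * φ t) *
          hardyNorm p f := by
  intro f hf
  obtain ⟨hfd, hfM⟩ := hf
  have hopen : IsOpen {z : ℂ | 0 < z.im} := isOpen_lt continuous_const Complex.continuous_im
  set g : ℂ → ℂ := {z : ℂ | 0 < z.im}.indicator f with hgdef
  have hgf : ∀ z : ℂ, 0 < z.im → g z = f z := fun z hz => indicator_of_mem (s := {z : ℂ | 0 < z.im}) hz f
  have gm : Measurable g := by
    classical
    rw [hgdef, ← piecewise_eq_indicator]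
    exact hfd.continuousOn.measurable_piecewise continuousOn_const hopen.measurableSet
  have hgd : DifferentiableOn ℂ g {z : ℂ | 0 < z.im} := hfd.congr hgf
  have hb : ∀ y : ℝ, 0 < y →
      eLpNorm (fun x : ℝ => g (x + y * Complex.I)) p volume ≤ hardyNorm p f := by
    intro y hy
    have : (fun x : ℝ => g (x + y * Complex.I)) = fun x : ℝ => f (x + y * Complex.I) := by
      funext x
      exact hgf _ (by simpa using hy)
    rw [this]
    exact le_iSup₂ (f := fun (y : ℝ) (_ : y ∈ Ioi (0:ℝ)) =>
      eLpNorm (fun x : ℝ => f (x + y * Complex.I)) p volume) y hy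
  have hH : ∀ z : ℂ, 0 < z.im → hausdorffC φ f z = hausdorffC φ g z := by
    intro z hz
    refine setIntegral_congr_fun measurableSet_Ioi fun t ht => ?_
    change _ = (φ t / t) • g (z / (t : ℂ))
    rw [hgf]
    rw [Complex.div_ofReal_im]
    exact div_pos hz ht
  have hnorm : hardyNorm p (hausdorffC φ f) ≤
        ENNReal.ofReal (∫ t in Set.Ioi (0 : ℝ), t ^ ((1 / p).toReal - 1) * φ t) *
          hardyNorm p f := by
    refine iSup₂_le fun y hy => ?_
    have : (fun x : ℝ => hausdorffC φ f (x + y * Complex.I)) =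
        fun x : ℝ => hausdorffC φ g (x + y * Complex.I) := by
      funext x
      exact hH _ (by simpa using hy)
    rw [this]
    exact aux_norm p hp hptop φ hφ hint g gm _ hb y hy
  obtain ⟨K, hK, hKb⟩ := aux_point p hp hptop g gm hgd _ hfM.ne hb
  exact ⟨⟨(aux_diff _ φ hφ hloc hint g gm ENNReal.toReal_nonneg hgd K hK hKb).congr hH,
    hnorm.trans_lt (ENNReal.mul_lt_top ENNReal.ofReal_lt_top hfM)⟩, hnorm⟩
end

section
/- Let φ be a nonnegative function in L¹_loc(0,∞). If H_φ is bounded on the real Hardy space H¹(ℝ) (with the norm ‖f‖ := ‖f‖_{L¹(ℝ)} + ‖H(f)‖_{L¹(ℝ)}), then ∫₀^∞ φ(t) dt ≤ ‖H_φ‖_{H¹(ℝ) → H¹(ℝ)} < ∞. -/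
open MeasureTheory Complex Filter Set Topology ENNReal NNReal

/-- The Hausdorff operator on functions on the real line:
`H_φ f (x) = ∫₀^∞ f(x/t) φ(t)/t dt`. -/
noncomputable def hausdorffR (φ : ℝ → ℝ) (f : ℝ → ℂ) (x : ℝ) : ℂ :=
  ∫ t in Set.Ioi (0 : ℝ), (φ t / t) • f (x / t)

/-- The Hilbert transform `H f (x) = (1/π) p.v. ∫ f(y)/(x-y) dy`, defined as the
limit as `ε → 0⁺` of the truncated singular integrals. -/
noncomputable def hilbertT (f : ℝ → ℂ) (x : ℝ) : ℂ :=
  (Real.pi)⁻¹ • limUnder (𝓝[>] (0 : ℝ))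
    (fun ε : ℝ => ∫ y in {y : ℝ | ε ≤ |x - y|}, f y / ((x : ℂ) - (y : ℂ)))

/-- Membership in the real Hardy space `H¹(ℝ)`: `f ∈ L¹(ℝ)` with `H f ∈ L¹(ℝ)`. -/
def MemH1 (f : ℝ → ℂ) : Prop :=
  Integrable f volume ∧ Integrable (hilbertT f) volume

/-- The norm on the real Hardy space: `‖f‖ = ‖f‖_{L¹} + ‖H f‖_{L¹}`. -/
noncomputable def h1Norm (f : ℝ → ℂ) : ℝ≥0∞ :=
  eLpNorm f 1 volume + eLpNorm (hilbertT f) 1 volume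


/-- test function -/
noncomputable def tf (R : ℝ) (y : ℝ) : ℂ :=
  ({y : ℝ | 1 ≤ |y| ∧ |y| ≤ R}).indicator (fun y => ((y⁻¹ : ℝ) : ℂ)) y

lemma aset_eq {t S : ℝ} (ht : 0 < t) (hS : t ≤ S) :
    {x : ℝ | t ≤ |x| ∧ |x| ≤ S} = Icc t S ∪ Icc (-S) (-t) := by
  ext x
  simp only [mem_ofPred_eq, mem_union, mem_Icc]
  constructor
  · rintro ⟨h1, h2⟩
    rcases abs_cases x with ⟨h, _⟩ | ⟨h, _⟩
    · left; constructor <;> linarith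
    · right; constructor <;> linarith
  · rintro (⟨h1, h2⟩ | ⟨h1, h2⟩)
    · rw [abs_of_pos (by linarith)]; exact ⟨h1, h2⟩
    · rw [abs_of_neg (by linarith)]; constructor <;> linarith

lemma lint_inv {t R : ℝ} (ht : 0 < t) (hR : 1 < R) :
    ∫⁻ x in Icc t (R * t), ENNReal.ofReal (|x|⁻¹) = ENNReal.ofReal (Real.log R) := by
  have hle : t ≤ R * t := by nlinarith
  have hint : IntegrableOn (fun x : ℝ => |x|⁻¹) (Icc t (R*t)) := by
    apply ContinuousOn.integrableOn_Icc
    apply ContinuousOn.inv₀ (by fun_prop)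
    intro x hx
    have : 0 < x := lt_of_lt_of_le ht hx.1
    positivity
  rw [← ofReal_integral_eq_lintegral_ofReal hint (ae_of_all _ fun x => by positivity),
    integral_Icc_eq_integral_Ioc, ← intervalIntegral.integral_of_le hle]
  congr 1
  have : ∫ x in t..R*t, |x|⁻¹ = ∫ x in t..R*t, x⁻¹ := by
    apply intervalIntegral.integral_congr
    intro x hx
    rw [uIcc_of_le hle] at hx
    have : 0 < x := lt_of_lt_of_le ht hx.1
    simp [abs_of_pos this]
  rw [this, integral_inv_of_pos ht (by positivity)]
  congr 1
  field_simp

lemma lint_inv_neg {t R : ℝ} (ht : 0 < t) (hR : 1 < R) :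
    ∫⁻ x in Icc (-(R * t)) (-t), ENNReal.ofReal (|x|⁻¹) = ENNReal.ofReal (Real.log R) := by
  rw [← lint_inv ht hR]
  have h := (Measure.measurePreserving_neg (volume : Measure ℝ)).setLIntegral_comp_preimage
    (s := Icc t (R*t)) measurableSet_Icc
    (f := fun x => ENNReal.ofReal (|x|⁻¹)) (by fun_prop)
  rw [← h]
  simp

lemma lint_J {t R : ℝ} (ht : 0 < t) (hR : 1 < R) :
    ∫⁻ x in {x : ℝ | t ≤ |x| ∧ |x| ≤ R * t}, ENNReal.ofReal (|x|⁻¹) =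
      ENNReal.ofReal (2 * Real.log R) := by
  rw [aset_eq ht (by nlinarith), lintegral_union measurableSet_Icc, lint_inv ht hR,
    lint_inv_neg ht hR, ← ENNReal.ofReal_add (Real.log_nonneg hR.le) (Real.log_nonneg hR.le)]
  · congr 1; ring
  · rw [Set.disjoint_left]; rintro x ⟨h1, _⟩ ⟨_, h2⟩; linarith

lemma meas_aset (t S : ℝ) : MeasurableSet {x : ℝ | t ≤ |x| ∧ |x| ≤ S} := by
  have h1 : MeasurableSet {x : ℝ | t ≤ |x|} := measurableSet_le measurable_const (by fun_prop)
  have h2 : MeasurableSet {x : ℝ | |x| ≤ S} := measurableSet_le (by fun_prop) measurable_const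
  exact h1.inter h2

lemma tf_norm {R : ℝ} (hR : 1 < R) :
    eLpNorm (tf R) 1 volume = ENNReal.ofReal (2 * Real.log R) := by
  rw [eLpNorm_one_eq_lintegral_enorm, ← lint_J one_pos hR, ← lintegral_indicator (meas_aset _ _)]
  congr 1; ext x
  simp only [tf, mul_one]
  rw [enorm_indicator_eq_indicator_enorm]
  congr 1; ext y
  rw [← ofReal_norm, Complex.norm_real, norm_inv, Real.norm_eq_abs]

lemma tf_int {R : ℝ} (hR : 1 < R) : Integrable (tf R) volume := by
  rw [← memLp_one_iff_integrable]
  refine ⟨?_, by rw [tf_norm hR]; exact ENNReal.ofReal_lt_top⟩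
  apply Measurable.aestronglyMeasurable
  unfold tf
  exact Measurable.indicator (by fun_prop) (meas_aset _ _)

lemma haus_tf {R : ℝ} (hR : 1 < R) (φ : ℝ → ℝ) (hφ : ∀ t, 0 ≤ φ t)
    (hloc : LocallyIntegrableOn φ (Set.Ioi 0)) {x : ℝ} (hx : x ≠ 0) :
    ‖hausdorffR φ (tf R) x‖ₑ =
      ∫⁻ t in Ioi (0:ℝ), ({p : ℝ × ℝ | p.2 ≤ |p.1| ∧ |p.1| ≤ R * p.2}).indicator
        (fun p => ENNReal.ofReal (|p.1|⁻¹) * ENNReal.ofReal (φ p.2)) (x, t) := by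
  have hx0 : 0 < |x| := abs_pos.mpr hx
  have hR0 : 0 < R := by linarith
  set I := Icc (|x| / R) |x| with hI
  have hIs : I ⊆ Ioi 0 := fun t ht => lt_of_lt_of_le (by positivity) ht.1
  have hint : IntegrableOn φ I := hloc.integrableOn_compact_subset hIs isCompact_Icc
  have h1 : hausdorffR φ (tf R) x = ((x⁻¹ * ∫ t in I, φ t : ℝ) : ℂ) := by
    unfold hausdorffR
    rw [← integral_const_mul, ← integral_complex_ofReal,
      ← integral_indicator measurableSet_Icc, ← integral_indicator measurableSet_Ioi]
    congr 1; ext t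
    by_cases ht : t ∈ Ioi (0:ℝ)
    · rw [indicator_of_mem ht]
      have ht' : 0 < t := ht
      have key : t ∈ I ↔ (x / t) ∈ {y : ℝ | 1 ≤ |y| ∧ |y| ≤ R} := by
        simp only [hI, mem_Icc, mem_ofPred_eq, abs_div, abs_of_pos ht']
        rw [le_div_iff₀ ht', div_le_iff₀ ht', div_le_iff₀ hR0, one_mul, and_comm, mul_comm]
      unfold tf
      by_cases hm : t ∈ I
      · rw [indicator_of_mem hm, indicator_of_mem (key.mp hm)]
        rw [Complex.real_smul, ← Complex.ofReal_mul]
        congr 1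
        field_simp
      · rw [indicator_of_notMem hm, indicator_of_notMem (fun h => hm (key.mpr h)), smul_zero]
    · rw [indicator_of_notMem ht, indicator_of_notMem (fun h => ht (hIs h))]
  rw [h1, ← ofReal_norm, Complex.norm_real, norm_mul, norm_inv, Real.norm_eq_abs,
    Real.norm_of_nonneg (integral_nonneg hφ), ENNReal.ofReal_mul (by positivity),
    ofReal_integral_eq_lintegral_ofReal hint (ae_of_all _ hφ),
    ← lintegral_const_mul' _ _ ENNReal.ofReal_ne_top,
    ← lintegral_indicator measurableSet_Icc, ← lintegral_indicator measurableSet_Ioi]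
  congr 1; ext t
  by_cases ht : t ∈ Ioi (0:ℝ)
  · rw [indicator_of_mem ht]
    simp only [indicator, hI, mem_Icc, mem_ofPred_eq]
    congr 1
    rw [div_le_iff₀ hR0, and_comm, mul_comm]
  · rw [indicator_of_notMem ht, indicator_of_notMem (fun h => ht (hIs h))]

lemma haus_norm {R : ℝ} (hR : 1 < R) (φ : ℝ → ℝ) (hφ : ∀ t, 0 ≤ φ t)
    (hloc : LocallyIntegrableOn φ (Set.Ioi 0)) :
    eLpNorm (hausdorffR φ (tf R)) 1 volume =
      ENNReal.ofReal (2 * Real.log R) * ∫⁻ t in Set.Ioi (0 : ℝ), ENNReal.ofReal (φ t) := by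
  have hm : AEMeasurable φ (volume.restrict (Ioi 0)) :=
    (hloc.aestronglyMeasurable).aemeasurable
  have hset : MeasurableSet {p : ℝ × ℝ | p.2 ≤ |p.1| ∧ |p.1| ≤ R * p.2} := by
    have h1 : MeasurableSet {p : ℝ × ℝ | p.2 ≤ |p.1|} :=
      measurableSet_le (by fun_prop) (by fun_prop)
    have h2 : MeasurableSet {p : ℝ × ℝ | |p.1| ≤ R * p.2} :=
      measurableSet_le (by fun_prop) (by fun_prop)
    exact h1.inter h2
  rw [eLpNorm_one_eq_lintegral_enorm]
  have hne : ∀ᵐ x : ℝ, x ≠ 0 := by simp [ae_iff]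
  rw [lintegral_congr_ae (hne.mono fun x hx => haus_tf hR φ hφ hloc hx)]
  rw [lintegral_lintegral_swap]
  · rw [← lintegral_const_mul' _ _ ENNReal.ofReal_ne_top]
    apply setLIntegral_congr_fun measurableSet_Ioi
    intro t ht
    have ht' : 0 < t := ht
    simp only
    rw [← lint_J ht' hR, ← lintegral_mul_const' _ _ ENNReal.ofReal_ne_top,
      ← lintegral_indicator (meas_aset _ _)]
    congr 1
  · apply AEMeasurable.indicator _ hset
    have m1 : AEMeasurable (fun p : ℝ × ℝ => ENNReal.ofReal (|p.1|⁻¹))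
        (volume.prod (volume.restrict (Ioi 0))) := by fun_prop
    have m2 : AEMeasurable (fun p : ℝ × ℝ => ENNReal.ofReal (φ p.2))
        (volume.prod (volume.restrict (Ioi 0))) := (hm.comp_snd).ennreal_ofReal
    exact m1.mul m2

lemma final_arith (A C K : ℝ≥0∞) (hK : K ≠ ⊤)
    (h : ∀ R : ℝ, 1 < R → ENNReal.ofReal (2 * Real.log R) * A ≤
      C * (ENNReal.ofReal (2 * Real.log R) + K)) : A ≤ C := by
  by_cases hC : C = ⊤
  · simp [hC]
  have h2 : ∀ n : ℕ, A ≤ C * (1 + K * ((n + 1 : ℕ) : ℝ≥0∞)⁻¹) := by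
    intro n
    have hh := h (Real.exp ((n + 1 : ℕ) / 2)) (by rw [Real.one_lt_exp_iff]; positivity)
    rw [Real.log_exp, mul_div_cancel₀ _ (two_ne_zero), ENNReal.ofReal_natCast] at hh
    have hn0 : ((n + 1 : ℕ) : ℝ≥0∞) ≠ 0 := by simp
    have hn1 : ((n + 1 : ℕ) : ℝ≥0∞) ≠ ⊤ := ENNReal.natCast_ne_top _
    calc A = ((n + 1 : ℕ) : ℝ≥0∞)⁻¹ * (((n + 1 : ℕ) : ℝ≥0∞) * A) := by
          rw [← mul_assoc, ENNReal.inv_mul_cancel hn0 hn1, one_mul]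
      _ ≤ ((n + 1 : ℕ) : ℝ≥0∞)⁻¹ * (C * (((n + 1 : ℕ) : ℝ≥0∞) + K)) := by gcongr
      _ = C * (((n + 1 : ℕ) : ℝ≥0∞)⁻¹ * ((n + 1 : ℕ) : ℝ≥0∞) + K * ((n + 1 : ℕ) : ℝ≥0∞)⁻¹) := by
          ring
      _ = _ := by rw [ENNReal.inv_mul_cancel hn0 hn1]
  have h3 : Tendsto (fun n : ℕ => C * (1 + K * ((n + 1 : ℕ) : ℝ≥0∞)⁻¹)) atTop
      (𝓝 (C * (1 + K * 0))) := by
    have t1 : Tendsto (fun n : ℕ => ((n + 1 : ℕ) : ℝ≥0∞)⁻¹) atTop (𝓝 0) :=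
      ENNReal.tendsto_inv_nat_nhds_zero.comp (tendsto_add_atTop_nat 1)
    exact ENNReal.Tendsto.const_mul
      (tendsto_const_nhds.add (ENNReal.Tendsto.const_mul t1 (Or.inr hK))) (Or.inr hC)
  have := ge_of_tendsto' h3 h2
  simpa using this

/-- kernel -/
noncomputable def kM (u : ℝ) : ℝ := (Real.log (1 + u) - Real.log (1 - u)) / u

lemma log_small {v : ℝ} (hv : |v| ≤ 1/2) : |Real.log (1 + v)| ≤ 2 * |v| := by
  have h := abs_le.mp hv
  have hp : 0 < 1 + v := by linarith
  have h1 := Real.log_le_sub_one_of_pos hp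
  have h2 := Real.one_sub_inv_le_log_of_pos hp
  have h3 : 1 - (1 + v)⁻¹ = v / (1 + v) := by field_simp; ring
  rw [abs_le]
  constructor
  · have : -(2 * |v|) ≤ v / (1 + v) := by
      rw [le_div_iff₀ hp]
      nlinarith [neg_abs_le v, le_abs_self v, abs_nonneg v]
    linarith
  · nlinarith [le_abs_self v, abs_nonneg v]

lemma kM_small {v : ℝ} (hv : |v| ≤ 1/2) : |Real.log (1 + v) - Real.log (1 - v)| ≤ 4 * |v| := by
  have h1 := log_small hv
  have h2 := log_small (v := -v) (by rwa [abs_neg])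
  rw [abs_neg, ← sub_eq_add_neg] at h2
  calc _ ≤ |Real.log (1 + v)| + |Real.log (1 - v)| := abs_sub _ _
    _ ≤ _ := by linarith

lemma kM_inv {u : ℝ} (hu : 2 ≤ |u|) : Real.log (1 + u) - Real.log (1 - u) =
    Real.log (1 + u⁻¹) - Real.log (1 - u⁻¹) := by
  have hu0 : u ≠ 0 := by rintro rfl; simp at hu; linarith
  have ha : 1 + u ≠ 0 := by
    intro h; have : u = -1 := by linarith
    rw [this] at hu; norm_num at hu
  have hb : 1 - u ≠ 0 := by
    intro h; have : u = 1 := by linarith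
    rw [this] at hu; norm_num at hu
  have e1 : 1 + u⁻¹ = (1 + u) / u := by field_simp; ring
  have e2 : 1 - u⁻¹ = -(1 - u) / u := by field_simp; ring
  rw [e1, e2, Real.log_div ha hu0, Real.log_div (neg_ne_zero.mpr hb) hu0, Real.log_neg_eq_log]
  ring

lemma kM_integrable : Integrable kM := by
  have hlog1 : IntegrableOn (fun u : ℝ => Real.log (1 + u)) (Icc (-2) 2) := by
    rw [integrableOn_Icc_iff_integrableOn_Ioc,
      ← intervalIntegrable_iff_integrableOn_Ioc_of_le (by norm_num)]
    have := (intervalIntegral.intervalIntegrable_log' (a := -1) (b := 3)).comp_add_left 1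
    norm_num at this
    exact this
  have hlog2 : IntegrableOn (fun u : ℝ => Real.log (1 - u)) (Icc (-2) 2) := by
    rw [integrableOn_Icc_iff_integrableOn_Ioc,
      ← intervalIntegrable_iff_integrableOn_Ioc_of_le (by norm_num)]
    have := (intervalIntegral.intervalIntegrable_log' (a := 3) (b := -1)).comp_sub_left 1
    norm_num at this
    exact this
  have hD : Integrable (fun u : ℝ => 5 * (1 + u ^ 2)⁻¹ +
      (Icc (-2:ℝ) 2).indicator (fun u => 2 * (|Real.log (1 + u)| + |Real.log (1 - u)|)) u) := by
    apply (integrable_inv_one_add_sq.const_mul 5).add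
    rw [integrable_indicator_iff measurableSet_Icc]
    exact (hlog1.abs.add hlog2.abs).const_mul 2
  apply hD.mono' (by unfold kM; exact Measurable.aestronglyMeasurable (by fun_prop))
  refine ae_of_all _ fun u => ?_
  rw [Real.norm_eq_abs]
  have hind : 0 ≤ (Icc (-2:ℝ) 2).indicator
      (fun u => 2 * (|Real.log (1 + u)| + |Real.log (1 - u)|)) u :=
    indicator_nonneg (fun _ _ => by positivity) _
  have hinv : 0 ≤ 5 * (1 + u ^ 2)⁻¹ := by positivity
  unfold kM
  rw [abs_div]
  rcases eq_or_ne u 0 with rfl | hu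
  · simp only [abs_zero, _root_.div_zero]; exact add_nonneg hinv hind
  have hu0 : 0 < |u| := abs_pos.mpr hu
  by_cases h1 : |u| ≤ 1/2
  · have : |Real.log (1 + u) - Real.log (1 - u)| / |u| ≤ 4 := by
      rw [div_le_iff₀ hu0]; exact kM_small h1
    have h2 : 4 ≤ 5 * (1 + u ^ 2)⁻¹ := by
      rw [← div_eq_mul_inv, le_div_iff₀ (by positivity), ← sq_abs]
      nlinarith
    linarith
  by_cases h2 : 2 ≤ |u|
  · rw [kM_inv h2]
    have h3 := kM_small (v := u⁻¹) (by
      rw [abs_inv, one_div]; exact inv_anti₀ (by norm_num) h2)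
    have h4 : 4 * |u⁻¹| / |u| ≤ 5 * (1 + u ^ 2)⁻¹ := by
      rw [abs_inv, ← sq_abs]
      have : 4 ≤ |u| ^ 2 := by nlinarith
      rw [← div_eq_mul_inv, ← div_eq_mul_inv, div_div, div_le_div_iff₀ (by positivity) (by positivity)]
      nlinarith
    have h5 : |Real.log (1 + u⁻¹) - Real.log (1 - u⁻¹)| / |u| ≤ 4 * |u⁻¹| / |u| := by gcongr
    linarith
  · push Not at h1 h2
    have hm : u ∈ Icc (-2:ℝ) 2 := abs_le.mp h2.le
    rw [indicator_of_mem hm]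
    have h3 : |Real.log (1 + u) - Real.log (1 - u)| / |u| ≤
        2 * (|Real.log (1 + u)| + |Real.log (1 - u)|) := by
      rw [div_le_iff₀ hu0]
      have := abs_sub (Real.log (1 + u)) (Real.log (1 - u))
      have hp : 0 ≤ |Real.log (1 + u)| + |Real.log (1 - u)| := by positivity
      nlinarith
    linarith

/-- antiderivative of `1/(y(x-y))` -/
noncomputable def aF (x y : ℝ) : ℝ := x⁻¹ * (Real.log y - Real.log (x - y))

lemma aF_int {x a b : ℝ} (hx : x ≠ 0) (hab : a ≤ b) (h0 : (0:ℝ) ∉ Icc a b) (hxI : x ∉ Icc a b) :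
    IntegrableOn (fun y : ℝ => y⁻¹ / (x - y)) (Icc a b) ∧
    ∫ y in Icc a b, y⁻¹ / (x - y) = aF x b - aF x a := by
  have n0 : ∀ y ∈ Icc a b, y ≠ 0 := fun y hy h => h0 (h ▸ hy)
  have nx : ∀ y ∈ Icc a b, x - y ≠ 0 := fun y hy h => hxI (by
    have : x = y := by linarith
    rwa [this])
  have hc : ContinuousOn (fun y : ℝ => y⁻¹ / (x - y)) (Icc a b) :=
    (continuousOn_id.inv₀ n0).div (by fun_prop) nx
  refine ⟨hc.integrableOn_Icc, ?_⟩
  rw [integral_Icc_eq_integral_Ioc, ← intervalIntegral.integral_of_le hab]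
  apply intervalIntegral.integral_eq_sub_of_hasDerivAt
  · intro y hy
    rw [uIcc_of_le hab] at hy
    have d1 := Real.hasDerivAt_log (n0 y hy)
    have d2 := (((hasDerivAt_id y).const_sub x)).log (nx y hy)
    have d3 := (d1.sub d2).const_mul x⁻¹
    refine d3.congr_deriv ?_
    have := n0 y hy
    have := nx y hy
    simp only [id]
    field_simp
    ring
  · rw [intervalIntegrable_iff_integrableOn_Icc_of_le hab]
    exact hc.integrableOn_Icc

lemma pv_piece {x a b : ℝ} (hx : x ≠ 0) (hab : a < b) (h0 : (0:ℝ) ∉ Icc a b)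
    (hxa : x ≠ a) (hxb : x ≠ b) :
    Tendsto (fun ε : ℝ => ∫ y in Icc a b ∩ {y : ℝ | ε ≤ |x - y|}, y⁻¹ / (x - y)) (𝓝[>] 0)
      (𝓝 (aF x b - aF x a)) := by
  by_cases hxI : x ∈ Icc a b
  · have h1 : a < x := lt_of_le_of_ne hxI.1 hxa.symm
    have h2 : x < b := lt_of_le_of_ne hxI.2 hxb
    have hev : ∀ᶠ ε in 𝓝[>] (0:ℝ), 0 < ε ∧ ε < x - a ∧ ε < b - x := by
      filter_upwards [Ioo_mem_nhdsGT (show (0:ℝ) < min (x - a) (b - x) by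
        apply lt_min <;> linarith)] with ε hε
      exact ⟨hε.1, lt_of_lt_of_le hε.2 (min_le_left _ _), lt_of_lt_of_le hε.2 (min_le_right _ _)⟩
    have hlim : Tendsto (fun ε : ℝ => (aF x b - aF x a) +
        x⁻¹ * (Real.log (x - ε) - Real.log (x + ε))) (𝓝[>] 0) (𝓝 (aF x b - aF x a)) := by
      have c : ContinuousAt (fun ε : ℝ => (aF x b - aF x a) +
        x⁻¹ * (Real.log (x - ε) - Real.log (x + ε))) 0 := by
        have c1 : ContinuousAt (fun ε : ℝ => Real.log (x - ε)) 0 :=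
          ContinuousAt.log (by fun_prop) (by simpa using hx)
        have c2 : ContinuousAt (fun ε : ℝ => Real.log (x + ε)) 0 :=
          ContinuousAt.log (by fun_prop) (by simpa using hx)
        fun_prop
      have := c.tendsto.mono_left (nhdsWithin_le_nhds (s := Ioi 0))
      simpa using this
    refine hlim.congr' ?_
    filter_upwards [hev] with ε ⟨e0, e1, e2⟩
    have hs : Icc a b ∩ {y : ℝ | ε ≤ |x - y|} = Icc a (x - ε) ∪ Icc (x + ε) b := by
      ext y
      simp only [mem_inter_iff, mem_Icc, mem_ofPred_eq, mem_union, le_abs]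
      constructor
      · rintro ⟨⟨p, q⟩, r | r⟩
        · left; constructor <;> linarith
        · right; constructor <;> linarith
      · rintro (⟨p, q⟩ | ⟨p, q⟩)
        · exact ⟨⟨by linarith, by linarith⟩, Or.inl (by linarith)⟩
        · exact ⟨⟨by linarith, by linarith⟩, Or.inr (by linarith)⟩
    obtain ⟨i1, v1⟩ := aF_int hx (a := a) (b := x - ε) (by linarith)
      (fun h => h0 ⟨h.1, by linarith [h.2]⟩) (fun h => by linarith [h.2])
    obtain ⟨i2, v2⟩ := aF_int hx (a := x + ε) (b := b) (by linarith)
      (fun h => h0 ⟨by linarith [h.1], h.2⟩) (fun h => by linarith [h.1])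
    rw [hs, setIntegral_union _ measurableSet_Icc i1 i2, v1, v2]
    · unfold aF
      rw [show x - (x - ε) = ε by ring, show x - (x + ε) = -ε by ring, Real.log_neg_eq_log]
      ring
    · rw [Set.disjoint_left]; rintro y ⟨_, p⟩ ⟨q, _⟩; linarith
  · have hev : ∀ᶠ ε in 𝓝[>] (0:ℝ), Icc a b ∩ {y : ℝ | ε ≤ |x - y|} = Icc a b := by
      have ho : (Icc a b)ᶜ ∈ 𝓝 x := isClosed_Icc.isOpen_compl.mem_nhds hxI
      obtain ⟨δ, hδ, hb⟩ := Metric.mem_nhds_iff.mp ho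
      filter_upwards [Ioo_mem_nhdsGT hδ] with ε hε
      rw [inter_eq_left]
      intro y hy
      by_contra hlt
      simp only [mem_ofPred_eq, not_le] at hlt
      refine hb (?_ : y ∈ Metric.ball x δ) hy
      rw [Metric.mem_ball, dist_comm, Real.dist_eq]
      linarith [hε.2]
    refine tendsto_const_nhds.congr' ?_
    filter_upwards [hev] with ε hε
    rw [hε, (aF_int hx hab.le h0 hxI).2]

lemma piece_integrable {x a b ε : ℝ} (hε : 0 < ε) (h0 : (0:ℝ) ∉ Icc a b) :
    IntegrableOn (fun y : ℝ => y⁻¹ / (x - y)) (Icc a b ∩ {y : ℝ | ε ≤ |x - y|}) := by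
  have hcl : IsClosed {y : ℝ | ε ≤ |x - y|} := isClosed_le continuous_const (by fun_prop)
  apply ContinuousOn.integrableOn_compact (isCompact_Icc.inter_right hcl)
  apply ContinuousOn.div
  · exact continuousOn_id.inv₀ (fun y hy h => h0 (h ▸ hy.1))
  · fun_prop
  · intro y hy h
    have := hy.2
    simp only [mem_ofPred_eq, h, abs_zero] at this
    linarith

lemma hilbert_tf {R : ℝ} (hR : 1 < R) {x : ℝ} (hx : x ≠ 0) (h1 : x ≠ 1) (h2 : x ≠ -1)
    (h3 : x ≠ R) (h4 : x ≠ -R) :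
    hilbertT (tf R) x = ((Real.pi⁻¹ * (R⁻¹ * kM (x / R) - kM x) : ℝ) : ℂ) := by
  have z1 : (0:ℝ) ∉ Icc 1 R := fun h => by linarith [h.1]
  have z2 : (0:ℝ) ∉ Icc (-R) (-1) := fun h => by linarith [h.2]
  have hR0 : R ≠ 0 := by linarith
  have T := (pv_piece hx hR z1 h1 h3).add (pv_piece hx (neg_lt_neg hR) z2 h4 h2)
  have hval : aF x R - aF x 1 + (aF x (-1) - aF x (-R)) = R⁻¹ * kM (x / R) - kM x := by
    unfold aF kM
    have a1 : R + x ≠ 0 := fun h => h4 (by linarith)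
    have a2 : R - x ≠ 0 := fun h => h3 (by linarith)
    rw [show 1 + x / R = (R + x) / R by field_simp, show 1 - x / R = (R - x) / R by field_simp,
      Real.log_div a1 hR0, Real.log_div a2 hR0, Real.log_neg_eq_log, Real.log_neg_eq_log,
      show x - -1 = 1 + x by ring, show x - -R = R + x by ring,
      show x - 1 = -(1 - x) by ring, show x - R = -(R - x) by ring,
      Real.log_neg_eq_log, Real.log_neg_eq_log]
    field_simp
    ring
  rw [hval] at T
  have T2 := (Complex.continuous_ofReal.tendsto _).comp T
  unfold hilbertT
  have T3 : Tendsto (fun ε : ℝ => ∫ y in {y : ℝ | ε ≤ |x - y|}, tf R y / ((x : ℂ) - (y : ℂ)))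
      (𝓝[>] (0 : ℝ)) (𝓝 ((R⁻¹ * kM (x / R) - kM x : ℝ) : ℂ)) := by
    refine T2.congr' ?_
    filter_upwards [self_mem_nhdsWithin] with ε hε
    have hε' : 0 < ε := hε
    have hme : MeasurableSet {y : ℝ | ε ≤ |x - y|} :=
      measurableSet_le measurable_const (by fun_prop)
    simp only [Function.comp]
    rw [← setIntegral_union _ (measurableSet_Icc.inter hme) (piece_integrable hε' z1)
      (piece_integrable hε' z2), ← integral_complex_ofReal, ← union_inter_distrib_right,
      ← aset_eq one_pos hR.le, inter_comm, ← setIntegral_indicator (meas_aset _ _)]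
    · congr 1; ext y
      unfold tf
      by_cases hy : y ∈ {y : ℝ | 1 ≤ |y| ∧ |y| ≤ R}
      · rw [indicator_of_mem hy, indicator_of_mem hy]; push_cast; rfl
      · rw [indicator_of_notMem hy, indicator_of_notMem hy, zero_div]
    · rw [Set.disjoint_left]; rintro y ⟨⟨p, _⟩, _⟩ ⟨⟨_, q⟩, _⟩; linarith
  rw [T3.limUnder_eq, Complex.real_smul]
  push_cast; rfl

lemma hilbert_ae {R : ℝ} (hR : 1 < R) :
    hilbertT (tf R) =ᵐ[volume]
      fun x => ((Real.pi⁻¹ * (R⁻¹ * kM (x / R) - kM x) : ℝ) : ℂ) := by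
  have : ∀ c : ℝ, ∀ᵐ x : ℝ, x ≠ c := fun c => by simp [ae_iff]
  filter_upwards [this 0, this 1, this (-1), this R, this (-R)] with x a b c d e
  exact hilbert_tf hR a b c d e

lemma hilbert_int {R : ℝ} (hR : 1 < R) : Integrable (hilbertT (tf R)) volume := by
  refine Integrable.congr ?_ (hilbert_ae hR).symm
  exact ((((kM_integrable.comp_div (by linarith : R ≠ 0)).const_mul R⁻¹).sub
    kM_integrable).const_mul _).ofReal

lemma hilbert_norm {R : ℝ} (hR : 1 < R) : eLpNorm (hilbertT (tf R)) 1 volume ≤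
    ENNReal.ofReal (Real.pi⁻¹ * (2 * ∫ x, |kM x|)) := by
  have hR0 : 0 < R := by linarith
  have i1 : Integrable (fun x => R⁻¹ * |kM (x / R)|) :=
    ((kM_integrable.abs.comp_div hR0.ne').const_mul R⁻¹)
  have i2 := kM_integrable.abs
  rw [eLpNorm_congr_ae (hilbert_ae hR), eLpNorm_one_eq_lintegral_enorm]
  have hv : Real.pi⁻¹ * (2 * ∫ x, |kM x|) =
      ∫ x, Real.pi⁻¹ * (R⁻¹ * |kM (x / R)| + |kM x|) := by
    rw [integral_const_mul, integral_add i1 i2, integral_const_mul,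
      Measure.integral_comp_div (fun x => |kM x|), abs_of_pos hR0, smul_eq_mul,
      inv_mul_cancel_left₀ hR0.ne']
    ring
  have i3 : Integrable (fun x => Real.pi⁻¹ * (R⁻¹ * |kM (x / R)| + |kM x|)) :=
    (i1.add i2).const_mul _
  rw [hv, ofReal_integral_eq_lintegral_ofReal i3
    (ae_of_all _ fun x => by positivity)]
  apply lintegral_mono
  intro x
  simp only
  rw [← ofReal_norm, Complex.norm_real, norm_mul, Real.norm_eq_abs,
    abs_of_pos (inv_pos.mpr Real.pi_pos), Real.norm_eq_abs]
  gcongr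
  refine (abs_sub _ _).trans ?_
  rw [abs_mul, abs_of_pos (inv_pos.mpr hR0)]

/-- Theorem 3.4 (lower bound): if `H_φ` is bounded on `H¹(ℝ)`, then
`∫₀^∞ φ(t) dt ≤ ‖H_φ‖_{H¹ → H¹} < ∞`. -/
theorem hausdorff_H1_lower_bound (φ : ℝ → ℝ) (hφ : ∀ t, 0 ≤ φ t)
    (hloc : LocallyIntegrableOn φ (Set.Ioi 0))
    (hbdd : ∃ C : ℝ≥0∞, C < ⊤ ∧ ∀ f : ℝ → ℂ, MemH1 f →
      MemH1 (hausdorffR φ f) ∧ h1Norm (hausdorffR φ f) ≤ C * h1Norm f) :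
    (∫⁻ t in Set.Ioi (0 : ℝ), ENNReal.ofReal (φ t)) ≤
      sInf {C : ℝ≥0∞ | ∀ f : ℝ → ℂ, MemH1 f →
        h1Norm (hausdorffR φ f) ≤ C * h1Norm f} ∧
    sInf {C : ℝ≥0∞ | ∀ f : ℝ → ℂ, MemH1 f →
        h1Norm (hausdorffR φ f) ≤ C * h1Norm f} < ⊤ := by
  constructor
  · refine le_sInf fun C hC => ?_
    refine final_arith _ C (ENNReal.ofReal (Real.pi⁻¹ * (2 * ∫ x, |kM x|)))
      ENNReal.ofReal_ne_top fun R hR => ?_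
    rw [← haus_norm hR φ hφ hloc]
    calc eLpNorm (hausdorffR φ (tf R)) 1 volume ≤ h1Norm (hausdorffR φ (tf R)) := le_self_add
      _ ≤ C * h1Norm (tf R) := hC _ ⟨tf_int hR, hilbert_int hR⟩
      _ ≤ _ := by
        unfold h1Norm
        rw [tf_norm hR]
        gcongr
        exact hilbert_norm hR
  · obtain ⟨C, hC, h⟩ := hbdd
    exact lt_of_le_of_lt (sInf_le fun f hf => (h f hf).2) hC
end
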